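/- There exist real constants α and β with 0 < α and β < 1/2 such that for every integer n ≥ 1 one has P_n(True) = P_n(False) and α ≤ P_n(True) ≤ β, where True and False denote the two constant Boolean functions of n variables. -/

import Mathlib

/-- An and/or tree skeleton: leaves carry a variable index and a polarity
(`true` = positive literal, `false` = negated literal); internal nodes carry
a connective (`true` = AND, `false` = OR) and a list of children. -/
inductive AT (n : ℕ) : Type
  | leaf : Fin n → Bool → AT n
  | node : Bool → List (AT n) → AT n

namespace AT

/-- The connective at the root, if the root is an internal node. -/
def rootConn {n : ℕ} : AT n → Option Bool
  | .leaf _ _ => none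
  | .node c _ => some c

/-- Whether a tree is a single leaf. -/
def isLeafB {n : ℕ} : AT n → Bool
  | .leaf _ _ => true
  | .node _ _ => false

/-- The children of the root. -/
def rootChildren {n : ℕ} : AT n → List (AT n)
  | .leaf _ _ => []
  | .node _ ts => ts

/-- Well-formedness: an associative tree is a plane tree in which each internal
node has at least two children, no internal node has the same connective as its
parent (stratification), and leaves carry literals. -/
inductive WF {n : ℕ} : AT n → Prop
  | leaf (i : Fin n) (b : Bool) : WF (.leaf i b)
  | node (c : Bool) (ts : List (AT n)) :
      2 ≤ ts.length → (∀ t ∈ ts, WF t) → (∀ t ∈ ts, rootConn t ≠ some c) →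
      WF (.node c ts)

mutual
/-- The size of a tree: its total number of nodes. -/
def size {n : ℕ} : AT n → ℕ
  | .leaf _ _ => 1
  | .node _ ts => 1 + sizeList ts
def sizeList {n : ℕ} : List (AT n) → ℕ
  | [] => 0
  | t :: ts => size t + sizeList ts
end

mutual
/-- The Boolean function computed by a tree. -/
def eval {n : ℕ} : AT n → (Fin n → Bool) → Bool
  | .leaf i b, x => if b then x i else ! x i
  | .node c ts, x => evalList c ts x
def evalList {n : ℕ} : Bool → List (AT n) → (Fin n → Bool) → Bool
  | c, [], _ => c
  | c, t :: ts, x => if c then eval t x && evalList c ts x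
                     else eval t x || evalList c ts x
end

end AT

open AT

/-- Number of associative trees of size `m` in a family `𝒯`. -/
noncomputable def countIn (n : ℕ) (𝒯 : Set (AT n)) (m : ℕ) : ℕ :=
  Nat.card {t : AT n // t ∈ 𝒯 ∧ WF t ∧ size t = m}

/-- `A n m` is the number of associative trees of size `m` on `n` variables. -/
noncomputable def A (n m : ℕ) : ℕ := countIn n Set.univ m

/-- `Pmn n m f` is the proportion, among associative trees of size `m` on `n`
variables, of those computing the Boolean function `f`. -/
noncomputable def Pmn (n m : ℕ) (f : (Fin n → Bool) → Bool) : ℝ :=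
  (countIn n {t | eval t = f} m : ℝ) / (A n m : ℝ)

/-- Ratio of trees of size `m` in the family `𝒯` among all trees of size `m`. -/
noncomputable def ratio (n : ℕ) (𝒯 : Set (AT n)) (m : ℕ) : ℝ :=
  (countIn n 𝒯 m : ℝ) / (A n m : ℝ)

/-- `HasLimRatio n 𝒯 μ` : the limiting ratio of the family `𝒯` exists and is `μ`. -/
def HasLimRatio (n : ℕ) (𝒯 : Set (AT n)) (μ : ℝ) : Prop :=
  Filter.Tendsto (ratio n 𝒯) Filter.atTop (nhds μ)

/-- Extension of a Boolean function of `n₀` variables to `n ≥ n₀` variables. -/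
def extend {n₀ n : ℕ} (h : n₀ ≤ n) (f : (Fin n₀ → Bool) → Bool) :
    (Fin n → Bool) → Bool :=
  fun x => f (fun j => x (Fin.castLE h j))

open Classical in
/-- The tree size complexity of a Boolean function. -/
noncomputable def Lcomp (n : ℕ) (f : (Fin n → Bool) → Bool) : ℕ :=
  if f = (fun _ => true) ∨ f = (fun _ => false) then 0
  else if ∃ i : Fin n, f = (fun x => x i) ∨ f = (fun x => ! x i) then 2
  else sInf {m | ∃ t : AT n, WF t ∧ size t = m ∧ eval t = f}




namespace Sub
open Filter Topology PowerSeries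

/-- normalised Catalan numbers -/
noncomputable def cc (m : ℕ) : ℝ := (catalan m : ℝ) / 4 ^ m

lemma catalan_pos' (m : ℕ) : 0 < catalan m := by
  have h := succ_mul_catalan_eq_centralBinom m
  have h2 := Nat.centralBinom_pos m
  rcases Nat.eq_zero_or_pos (catalan m) with h0 | h0
  · rw [h0] at h; omega
  · exact h0

lemma cc_pos (m : ℕ) : 0 < cc m := by
  unfold cc
  have := catalan_pos' m
  positivity

lemma cc_ne (m : ℕ) : cc m ≠ 0 := (cc_pos m).ne'

lemma cc_ge (m : ℕ) : (1 / 4 : ℝ) ^ m ≤ cc m := by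
  unfold cc
  have : (1 : ℝ) ≤ catalan m := by exact_mod_cast catalan_pos' m
  rw [one_div, inv_pow, inv_eq_one_div]
  gcongr

lemma catalan_rec (m : ℕ) : (m + 2) * catalan (m + 1) = 2 * (2 * m + 1) * catalan m := by
  have h1 := succ_mul_catalan_eq_centralBinom m
  have h2 := succ_mul_catalan_eq_centralBinom (m + 1)
  have h3 := Nat.succ_mul_centralBinom_succ m
  rw [← h1, ← h2] at h3
  have : (m + 1) * ((m + 2) * catalan (m + 1)) = (m + 1) * (2 * (2 * m + 1) * catalan m) := by
    calc _ = (m + 1) * ((m + 1 + 1) * catalan (m + 1)) := by ring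
      _ = _ := h3
      _ = _ := by ring
  exact Nat.eq_of_mul_eq_mul_left (by omega) this

lemma cc_rec (m : ℕ) : ((m : ℝ) + 2) * cc (m + 1) = (m + 1 / 2) * cc m := by
  have h : ((m : ℝ) + 2) * catalan (m + 1) = 2 * (2 * m + 1) * catalan m := by
    exact_mod_cast catalan_rec m
  unfold cc
  rw [pow_succ]
  field_simp
  linarith

lemma cc_conv (m : ℕ) : ∑ p ∈ Finset.HasAntidiagonal.antidiagonal m, cc p.1 * cc p.2 = 4 * cc (m + 1) := by
  unfold cc
  rw [catalan_succ']
  push_cast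
  rw [pow_succ, Finset.sum_div, Finset.mul_sum]
  refine Finset.sum_congr rfl fun p hp => ?_
  rw [Finset.HasAntidiagonal.mem_antidiagonal] at hp
  rw [← hp, pow_add]
  field_simp

lemma cc_ratio : Tendsto (fun m => cc (m + 1) / cc m) atTop (𝓝 1) := by
  have h : ∀ m : ℕ, cc (m + 1) / cc m = 1 - (3 / 2) * (1 / ((m : ℝ) + 2)) := by
    intro m
    have := cc_rec m
    have h2 : ((m : ℝ) + 2) ≠ 0 := by positivity
    have h3 := cc_ne m
    field_simp
    linarith
  simp_rw [h]
  have h1 : Tendsto (fun m : ℕ => 1 / ((m : ℝ) + 2)) atTop (𝓝 0) := by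
    have := (tendsto_add_atTop_iff_nat 1).2 (tendsto_one_div_add_atTop_nhds_zero_nat (𝕜 := ℝ))
    refine this.congr fun m => ?_
    push_cast; ring_nf
  have := (h1.const_mul (3 / 2)).const_sub 1
  simpa using this

lemma cc_ratio_add (k : ℕ) : Tendsto (fun m => cc m / cc (m + k)) atTop (𝓝 1) := by
  induction k with
  | zero => simp [div_self (cc_ne _)]
  | succ k ih =>
    have h1 := ((tendsto_add_atTop_iff_nat k).2 cc_ratio).inv₀ one_ne_zero
    have := ih.mul h1
    simp only [inv_one, mul_one] at this
    refine this.congr fun m => ?_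
    have h1 := cc_ne (m + k)
    have h2 := cc_ne (m + k + 1)
    rw [← add_assoc]
    field_simp

lemma cc_ratio_sub (k : ℕ) : Tendsto (fun m => cc (m - k) / cc m) atTop (𝓝 1) := by
  rw [← tendsto_add_atTop_iff_nat k]
  simpa using cc_ratio_add k

lemma cc_partial (m : ℕ) : ∑ k ∈ Finset.range m, cc k = 2 - 2 * ((m + 1) * cc m) := by
  induction m with
  | zero => simp [cc]
  | succ m ih =>
    rw [Finset.sum_range_succ, ih]
    have := cc_rec m
    push_cast
    linarith

lemma cc_summable : Summable cc := by
  refine summable_of_sum_range_le (c := 2) (fun n => (cc_pos n).le) fun n => ?_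
  rw [cc_partial]
  have := cc_pos n
  have : 0 ≤ 2 * (((n : ℝ) + 1) * cc n) := by positivity
  linarith

lemma cc_tsum : ∑' m, cc m = 2 := by
  have hs : Summable fun m => ‖cc m‖ := by
    simpa [abs_of_pos (cc_pos _)] using cc_summable
  have h := tsum_mul_tsum_eq_tsum_sum_antidiagonal_of_summable_norm hs hs
  simp_rw [cc_conv] at h
  rw [tsum_mul_left] at h
  have h2 := cc_summable.tsum_eq_zero_add
  have h0 : cc 0 = 1 := by simp [cc]
  rw [h0] at h2
  nlinarith [sq_nonneg (∑' m, cc m - 2)]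

/-- boundedness with respect to the reference sequence -/
def Bd (F : ℝ⟦X⟧) : Prop := ∃ C : ℝ, 0 ≤ C ∧ ∀ m, |coeff m F| ≤ C * cc m

/-- normalised coefficients -/
noncomputable def nv (F : ℝ⟦X⟧) (m : ℕ) : ℝ := coeff m F / cc m

/-- limit of normalised coefficients -/
def Lim (F : ℝ⟦X⟧) (l : ℝ) : Prop := Tendsto (nv F) atTop (𝓝 l)

/-- value at one -/
noncomputable def ev (F : ℝ⟦X⟧) : ℝ := ∑' m, coeff m F
/-- absolute value at one -/
noncomputable def ea (F : ℝ⟦X⟧) : ℝ := ∑' m, |coeff m F|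

lemma coeff_eq_nv (F : ℝ⟦X⟧) (m : ℕ) : coeff m F = nv F m * cc m := by
  unfold nv; field_simp [cc_ne m]

lemma Bd.nv_le {F : ℝ⟦X⟧} {C : ℝ} (h : ∀ m, |coeff m F| ≤ C * cc m) (m : ℕ) : |nv F m| ≤ C := by
  unfold nv
  rw [abs_div, abs_of_pos (cc_pos m), div_le_iff₀ (cc_pos m)]
  exact h m

lemma Bd.summable {F : ℝ⟦X⟧} (h : Bd F) : Summable fun m => |coeff m F| := by
  obtain ⟨C, hC, h⟩ := h
  exact Summable.of_nonneg_of_le (fun _ => abs_nonneg _) h (cc_summable.mul_left C)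

lemma Bd.summable' {F : ℝ⟦X⟧} (h : Bd F) : Summable fun m => coeff m F := h.summable.of_abs

lemma Lim.bd {F : ℝ⟦X⟧} {l : ℝ} (h : Lim F l) : Bd F := by
  obtain ⟨C, hC⟩ := (h.abs).bddAbove_range
  have hC' : ∀ m, |nv F m| ≤ C := fun m => hC ⟨m, rfl⟩
  refine ⟨C, (abs_nonneg _).trans (hC' 0), fun m => ?_⟩
  rw [coeff_eq_nv, abs_mul, abs_of_pos (cc_pos m)]
  exact mul_le_mul_of_nonneg_right (hC' m) (cc_pos m).le

lemma Bd.add {F G : ℝ⟦X⟧} (hF : Bd F) (hG : Bd G) : Bd (F + G) := by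
  obtain ⟨C, hC, hF⟩ := hF
  obtain ⟨D, hD, hG⟩ := hG
  refine ⟨C + D, by positivity, fun m => ?_⟩
  rw [map_add, add_mul]
  exact (abs_add_le _ _).trans (add_le_add (hF m) (hG m))

lemma Bd.mul {F G : ℝ⟦X⟧} (hF : Bd F) (hG : Bd G) : Bd (F * G) := by
  obtain ⟨C, hC, hF⟩ := hF
  obtain ⟨D, hD, hG⟩ := hG
  refine ⟨C * D * 4, by positivity, fun m => ?_⟩
  rw [coeff_mul]
  have h1 : cc (m + 1) ≤ cc m := by
    have := cc_rec m
    have h2 := cc_pos m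
    have h3 := cc_pos (m + 1)
    have h4 : (0 : ℝ) ≤ m := Nat.cast_nonneg m
    nlinarith
  calc _ ≤ ∑ p ∈ Finset.HasAntidiagonal.antidiagonal m, |coeff p.1 F * coeff p.2 G| := Finset.abs_sum_le_sum_abs _ _
    _ ≤ ∑ p ∈ Finset.HasAntidiagonal.antidiagonal m, C * D * (cc p.1 * cc p.2) := by
      refine Finset.sum_le_sum fun p _ => ?_
      rw [abs_mul]
      calc _ ≤ (C * cc p.1) * (D * cc p.2) := by
            have := cc_pos p.1
            have := cc_pos p.2
            gcongr
            · exact hF _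
            · exact hG _
        _ = _ := by ring
    _ = C * D * 4 * cc (m + 1) := by rw [← Finset.mul_sum, cc_conv]; ring
    _ ≤ _ := by gcongr

lemma Bd.of_le {F G : ℝ⟦X⟧} (hG : Bd G) (h : ∀ m, 0 ≤ coeff m F) (h' : ∀ m, coeff m F ≤ coeff m G) :
    Bd F := by
  obtain ⟨C, hC, hG⟩ := hG
  refine ⟨C, hC, fun m => ?_⟩
  rw [abs_of_nonneg (h m)]
  exact (h' m).trans ((le_abs_self _).trans (hG m))

lemma ev_mul {F G : ℝ⟦X⟧} (hF : Bd F) (hG : Bd G) : ev (F * G) = ev F * ev G := by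
  unfold ev
  have := tsum_mul_tsum_eq_tsum_sum_antidiagonal_of_summable_norm
    (f := fun m => coeff m F) (g := fun m => coeff m G) hF.summable hG.summable
  rw [this]
  simp_rw [coeff_mul]

lemma ev_add {F G : ℝ⟦X⟧} (hF : Bd F) (hG : Bd G) : ev (F + G) = ev F + ev G := by
  unfold ev
  simp_rw [map_add]
  exact hF.summable'.tsum_add hG.summable'

lemma ea_eq_ev {F : ℝ⟦X⟧} (h : ∀ m, 0 ≤ coeff m F) : ea F = ev F := by
  unfold ea ev
  simp_rw [abs_of_nonneg (h _)]

lemma ea_nonneg (F : ℝ⟦X⟧) : 0 ≤ ea F := tsum_nonneg fun _ => abs_nonneg _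

lemma split_sum (φ : ℕ → ℝ) {K m : ℕ} (h : 2 * K ≤ m) :
    ∑ k ∈ Finset.range (m + 1), φ k = ∑ k ∈ Finset.range K, φ k + ∑ k ∈ Finset.range K, φ (m - k)
      + ∑ k ∈ Finset.Ico K (m + 1 - K), φ k := by
  have h1 : ∑ k ∈ Finset.range (m + 1), φ k = ∑ k ∈ Finset.range K, φ k
      + ∑ k ∈ Finset.Ico K (m + 1 - K), φ k + ∑ k ∈ Finset.Ico (m + 1 - K) (m + 1), φ k := by
    rw [Finset.sum_range_add_sum_Ico _ (by omega), Finset.sum_range_add_sum_Ico _ (by omega)]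
  have h2 : ∑ k ∈ Finset.Ico (m + 1 - K) (m + 1), φ k = ∑ k ∈ Finset.range K, φ (m - k) := by
    have := Finset.sum_Ico_reflect φ 0 (m := K) (n := m) (by omega)
    rw [← Finset.range_eq_Ico] at this
    rw [this]
    simp
  rw [h1, h2]; ring

/-- the error term in the product lemma -/
noncomputable def err (K m : ℕ) : ℝ :=
  4 * (cc (m + 1) / cc m) - 2 * ∑ k ∈ Finset.range K, cc k * (cc (m - k) / cc m)
    + 2 * ∑ k ∈ Finset.range K, cc k * |cc (m - k) / cc m - 1|

lemma err_tendsto (K : ℕ) :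
    Tendsto (err K) atTop (𝓝 (4 - 2 * ∑ k ∈ Finset.range K, cc k)) := by
  unfold err
  have h1 := cc_ratio.const_mul 4
  have h2 : Tendsto (fun m => ∑ k ∈ Finset.range K, cc k * (cc (m - k) / cc m)) atTop
      (𝓝 (∑ k ∈ Finset.range K, cc k * 1)) :=
    tendsto_finsetSum _ fun k _ => (cc_ratio_sub k).const_mul _
  have h3 : Tendsto (fun m => ∑ k ∈ Finset.range K, cc k * |cc (m - k) / cc m - 1|) atTop
      (𝓝 (∑ k ∈ Finset.range K, cc k * |1 - 1|)) :=
    tendsto_finsetSum _ fun k _ => (((cc_ratio_sub k).sub_const 1).abs).const_mul _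
  have := (h1.sub (h2.const_mul 2)).add (h3.const_mul 2)
  simpa using this

lemma err_small {ε : ℝ} (hε : 0 < ε) : ∀ᶠ K in atTop, ∀ᶠ m in atTop, err K m < ε := by
  have h := cc_summable.hasSum.tendsto_sum_nat
  rw [cc_tsum] at h
  have h2 : Tendsto (fun K => 4 - 2 * ∑ k ∈ Finset.range K, cc k) atTop (𝓝 0) := by
    have := (h.const_mul 2).const_sub 4
    norm_num at this
    exact this
  filter_upwards [h2.eventually_lt_const hε] with K hK
  exact (err_tendsto K).eventually_lt_const hK

lemma core_half {F G : ℝ⟦X⟧} {C D : ℝ} (hC : 0 ≤ C) (hD : 0 ≤ D)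
    (hF : ∀ m, |coeff m F| ≤ C * cc m) (hG : ∀ m, |coeff m G| ≤ D * cc m) (K m : ℕ) :
    |∑ k ∈ Finset.range K, coeff k F * coeff (m - k) G / cc m
      - ∑ k ∈ Finset.range K, coeff k F * nv G (m - k)|
      ≤ C * D * ∑ k ∈ Finset.range K, cc k * |cc (m - k) / cc m - 1| := by
  rw [← Finset.sum_sub_distrib, Finset.mul_sum]
  refine (Finset.abs_sum_le_sum_abs _ _).trans (Finset.sum_le_sum fun k _ => ?_)
  have : coeff k F * coeff (m - k) G / cc m - coeff k F * nv G (m - k)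
      = coeff k F * nv G (m - k) * (cc (m - k) / cc m - 1) := by
    rw [coeff_eq_nv G]; ring
  rw [this, abs_mul, abs_mul]
  calc _ ≤ (C * cc k) * D * |cc (m - k) / cc m - 1| := by
        have := cc_pos k
        gcongr
        · exact hF k
        · exact Bd.nv_le hG _
    _ = _ := by ring

lemma core {F G : ℝ⟦X⟧} {C D : ℝ} (hC : 0 ≤ C) (hD : 0 ≤ D)
    (hF : ∀ m, |coeff m F| ≤ C * cc m) (hG : ∀ m, |coeff m G| ≤ D * cc m) {K m : ℕ} (h : 2 * K ≤ m) :
    |nv (F * G) m - (∑ k ∈ Finset.range K, coeff k F * nv G (m - k)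
      + ∑ k ∈ Finset.range K, coeff k G * nv F (m - k))| ≤ C * D * err K m := by
  have e1 : nv (F * G) m = ∑ k ∈ Finset.range K, coeff k F * coeff (m - k) G / cc m
      + ∑ k ∈ Finset.range K, coeff k G * coeff (m - k) F / cc m
      + ∑ k ∈ Finset.Ico K (m + 1 - K), coeff k F * coeff (m - k) G / cc m := by
    unfold nv
    rw [coeff_mul, Finset.Nat.sum_antidiagonal_eq_sum_range_succ
      (fun i j => coeff i F * coeff j G), Finset.sum_div, Nat.succ_eq_add_one, split_sum _ h]
    congr 2
    refine Finset.sum_congr rfl fun k hk => ?_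
    rw [Finset.mem_range] at hk
    rw [Nat.sub_sub_self (by omega), mul_comm]
  have e2 : 4 * (cc (m + 1) / cc m) = ∑ k ∈ Finset.range K, cc k * (cc (m - k) / cc m)
      + ∑ k ∈ Finset.range K, cc k * (cc (m - k) / cc m)
      + ∑ k ∈ Finset.Ico K (m + 1 - K), cc k * (cc (m - k) / cc m) := by
    rw [← mul_div_assoc, ← cc_conv, Finset.Nat.sum_antidiagonal_eq_sum_range_succ
      (fun i j => cc i * cc j), Finset.sum_div, Nat.succ_eq_add_one, split_sum _ h]
    congr 1
    · congr 1
      · exact Finset.sum_congr rfl fun k hk => by ring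
      refine Finset.sum_congr rfl fun k hk => ?_
      rw [Finset.mem_range] at hk
      rw [Nat.sub_sub_self (by omega)]; ring
    · exact Finset.sum_congr rfl fun k hk => by ring
  have e3 : |∑ k ∈ Finset.Ico K (m + 1 - K), coeff k F * coeff (m - k) G / cc m|
      ≤ C * D * ∑ k ∈ Finset.Ico K (m + 1 - K), cc k * (cc (m - k) / cc m) := by
    rw [Finset.mul_sum]
    refine (Finset.abs_sum_le_sum_abs _ _).trans (Finset.sum_le_sum fun k _ => ?_)
    rw [abs_div, abs_mul, abs_of_pos (cc_pos m)]
    have := cc_pos m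
    have := cc_pos k
    have := cc_pos (m - k)
    calc _ ≤ (C * cc k) * (D * cc (m - k)) / cc m := by
          gcongr
          · exact hF k
          · exact hG _
      _ = _ := by ring
  have e4 := core_half hC hD hF hG K m
  have e5 := core_half hD hC hG hF K m
  have e6 : C * D * err K m = C * D * (∑ k ∈ Finset.Ico K (m + 1 - K), cc k * (cc (m - k) / cc m))
      + C * D * (∑ k ∈ Finset.range K, cc k * |cc (m - k) / cc m - 1|)
      + D * C * (∑ k ∈ Finset.range K, cc k * |cc (m - k) / cc m - 1|) := by
    unfold err
    rw [e2]; ring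
  rw [e1, e6]
  rw [abs_le] at *
  constructor <;> linarith [e3.1, e3.2, e4.1, e4.2, e5.1, e5.2]

lemma lim_mul {F G : ℝ⟦X⟧} {f g : ℝ} (hF : Lim F f) (hG : Lim G g) :
    Lim (F * G) (ev F * g + ev G * f) := by
  obtain ⟨C, hC, bF⟩ := hF.bd
  obtain ⟨D, hD, bG⟩ := hG.bd
  have sF := (hF.bd.summable'.hasSum.tendsto_sum_nat).mul_const g
  have sG := (hG.bd.summable'.hasSum.tendsto_sum_nat).mul_const f
  have sS := sF.add sG
  unfold Lim
  rw [Metric.tendsto_atTop']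
  intro ε hε
  have hCD : 0 < C * D + 1 := by positivity
  obtain ⟨K, hK1, hK2⟩ := ((err_small (ε := ε / (3 * (C * D + 1))) (by positivity)).and
    (Metric.tendsto_nhds.1 sS (ε / 3) (by positivity))).exists
  have sub : ∀ k : ℕ, Tendsto (fun m : ℕ => m - k) atTop atTop := fun k => tendsto_sub_atTop_nat k
  have t : Tendsto (fun m => ∑ k ∈ Finset.range K, coeff k F * nv G (m - k)
      + ∑ k ∈ Finset.range K, coeff k G * nv F (m - k)) atTop
      (𝓝 (∑ k ∈ Finset.range K, coeff k F * g + ∑ k ∈ Finset.range K, coeff k G * f)) :=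
    (tendsto_finsetSum _ fun k _ => (hG.comp (sub k)).const_mul _).add
      (tendsto_finsetSum _ fun k _ => (hF.comp (sub k)).const_mul _)
  have hh := (hK1.and (Metric.tendsto_nhds.1 t (ε / 3) (by positivity))).and
    (eventually_ge_atTop (2 * K))
  obtain ⟨M, hM⟩ := eventually_atTop.1 hh
  refine ⟨M, fun m hm => ?_⟩
  obtain ⟨⟨h1, h2⟩, h3⟩ := hM m (le_of_lt hm)
  have h4 := core hC hD bF bG h3
  rw [Real.dist_eq] at *
  rw [← Finset.sum_mul, ← Finset.sum_mul] at h2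
  have h5 : C * D * err K m ≤ ε / 3 := by
    have : C * D * err K m ≤ C * D * (ε / (3 * (C * D + 1))) := by gcongr
    refine this.trans ?_
    rw [mul_div_assoc', div_le_div_iff₀ (by positivity) (by positivity)]
    nlinarith
  simp only [ev]
  rw [abs_lt] at *
  rw [abs_le] at h4
  constructor <;> linarith [h4.1, h4.2, h2.1, h2.2, hK2.1, hK2.2]

/-- asymptotic oscillation bound -/
def OscLe (F : ℝ⟦X⟧) (a : ℝ) : Prop :=
  ∀ δ > 0, ∃ M, ∀ m ≥ M, ∀ m' ≥ M, |nv F m - nv F m'| ≤ a + δ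

lemma nv_add (F G : ℝ⟦X⟧) (m : ℕ) : nv (F + G) m = nv F m + nv G m := by
  simp [nv, add_div]

lemma OscLe.add {F G : ℝ⟦X⟧} {a b : ℝ} (hF : OscLe F a) (hG : OscLe G b) : OscLe (F + G) (a + b) := by
  intro δ hδ
  obtain ⟨M, hM⟩ := hF (δ / 2) (by positivity)
  obtain ⟨N, hN⟩ := hG (δ / 2) (by positivity)
  refine ⟨max M N, fun m hm m' hm' => ?_⟩
  have h1 := hM m (le_of_max_le_left hm) m' (le_of_max_le_left hm')
  have h2 := hN m (le_of_max_le_right hm) m' (le_of_max_le_right hm')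
  rw [nv_add, nv_add]
  rw [abs_le] at *
  constructor <;> linarith [h1.1, h1.2, h2.1, h2.2]

lemma Lim.osc {F : ℝ⟦X⟧} {l : ℝ} (h : Lim F l) : OscLe F 0 := by
  intro δ hδ
  obtain ⟨M, hM⟩ := Metric.cauchySeq_iff.1 h.cauchySeq δ hδ
  refine ⟨M, fun m hm m' hm' => ?_⟩
  have := hM m hm m' hm'
  rw [Real.dist_eq] at this
  linarith

lemma OscLe.lim {F : ℝ⟦X⟧} (h : OscLe F 0) : ∃ l, Lim F l := by
  refine cauchySeq_tendsto_of_complete (Metric.cauchySeq_iff.2 fun ε hε => ?_)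
  obtain ⟨M, hM⟩ := h (ε / 2) (by positivity)
  refine ⟨M, fun m hm m' hm' => ?_⟩
  rw [Real.dist_eq]
  linarith [hM m hm m' hm']

lemma OscLe.mono {F : ℝ⟦X⟧} {a b : ℝ} (hF : OscLe F a) (h : a ≤ b) : OscLe F b := by
  intro δ hδ
  obtain ⟨M, hM⟩ := hF δ hδ
  exact ⟨M, fun m hm m' hm' => (hM m hm m' hm').trans (by linarith)⟩

lemma lim_of_zero {F : ℝ⟦X⟧} {N : ℕ} (h : ∀ m ≥ N, coeff m F = 0) : Lim F 0 := by
  refine tendsto_const_nhds.congr' ?_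
  filter_upwards [eventually_ge_atTop N] with m hm
  simp [nv, h m hm]

lemma OscLe.sum {ι : Type*} {s : Finset ι} {F : ι → ℝ⟦X⟧} {a : ι → ℝ} (h : ∀ i ∈ s, OscLe (F i) (a i)) :
    OscLe (∑ i ∈ s, F i) (∑ i ∈ s, a i) := by
  classical
  induction s using Finset.induction_on with
  | empty => simpa using (lim_of_zero (F := 0) (N := 0) (by simp)).osc
  | insert i s hi ih =>
    rw [Finset.sum_insert hi, Finset.sum_insert hi]
    exact (h i (by simp)).add (ih fun j hj => h j (by simp [hj]))

lemma Bd.sum {ι : Type*} {s : Finset ι} {F : ι → ℝ⟦X⟧} (h : ∀ i ∈ s, Bd (F i)) :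
    Bd (∑ i ∈ s, F i) := by
  classical
  induction s using Finset.induction_on with
  | empty => simpa using (lim_of_zero (F := 0) (N := 0) (by simp)).bd
  | insert i s hi ih =>
    rw [Finset.sum_insert hi]
    exact (h i (by simp)).add (ih fun j hj => h j (by simp [hj]))

lemma ev_sum {ι : Type*} {s : Finset ι} {F : ι → ℝ⟦X⟧} (h : ∀ i ∈ s, Bd (F i)) :
    ev (∑ i ∈ s, F i) = ∑ i ∈ s, ev (F i) := by
  classical
  induction s using Finset.induction_on with
  | empty => simp [ev]
  | insert i s hi ih =>
    rw [Finset.sum_insert hi, Finset.sum_insert hi, ev_add (h i (by simp))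
      (Bd.sum fun j hj => h j (by simp [hj])), ih fun j hj => h j (by simp [hj])]

lemma osc_half {F G : ℝ⟦X⟧} {b : ℝ} (bF : Bd F) (hb : 0 ≤ b) (hG : OscLe G b) (K : ℕ) {δ : ℝ} (hδ : 0 < δ) :
    ∃ M, ∀ m ≥ M, ∀ m' ≥ M, |∑ k ∈ Finset.range K, coeff k F * nv G (m - k)
      - ∑ k ∈ Finset.range K, coeff k F * nv G (m' - k)| ≤ ea F * b + δ := by
  have hpos : 0 < ea F + 1 := by have := ea_nonneg F; positivity
  obtain ⟨M, hM⟩ := hG (δ / (ea F + 1)) (by positivity)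
  refine ⟨M + K, fun m hm m' hm' => ?_⟩
  rw [← Finset.sum_sub_distrib]
  calc _ ≤ ∑ k ∈ Finset.range K, |coeff k F| * (b + δ / (ea F + 1)) := by
        refine (Finset.abs_sum_le_sum_abs _ _).trans (Finset.sum_le_sum fun k hk => ?_)
        rw [Finset.mem_range] at hk
        rw [← mul_sub, abs_mul]
        gcongr
        exact hM _ (by omega) _ (by omega)
    _ = (∑ k ∈ Finset.range K, |coeff k F|) * (b + δ / (ea F + 1)) := by rw [Finset.sum_mul]
    _ ≤ ea F * (b + δ / (ea F + 1)) := by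
        gcongr
        exact bF.summable.sum_le_tsum _ fun _ _ => abs_nonneg _
    _ ≤ _ := by
        rw [mul_add]
        gcongr
        rw [mul_div_assoc', div_le_iff₀ hpos]
        nlinarith

lemma OscLe.mul {F G : ℝ⟦X⟧} {a b : ℝ} (bF : Bd F) (bG : Bd G) (ha : 0 ≤ a) (hb : 0 ≤ b)
    (hF : OscLe F a) (hG : OscLe G b) : OscLe (F * G) (ea F * b + ea G * a) := by
  intro δ hδ
  obtain ⟨C, hC, bF'⟩ := id bF
  obtain ⟨D, hD, bG'⟩ := id bG
  have hCD : 0 < C * D + 1 := by positivity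
  obtain ⟨K, hK1⟩ := (err_small (ε := δ / (4 * (C * D + 1))) (by positivity)).exists
  obtain ⟨M1, hM1⟩ := osc_half bF hb hG K (δ := δ / 4) (by positivity)
  obtain ⟨M2, hM2⟩ := osc_half bG ha hF K (δ := δ / 4) (by positivity)
  obtain ⟨M3, hM3⟩ := eventually_atTop.1 (hK1.and (eventually_ge_atTop (2 * K)))
  have key : ∀ m ≥ M3, |nv (F * G) m - (∑ k ∈ Finset.range K, coeff k F * nv G (m - k)
      + ∑ k ∈ Finset.range K, coeff k G * nv F (m - k))| ≤ δ / 4 := by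
    intro m hm
    obtain ⟨h1, h2⟩ := hM3 m hm
    refine (core hC hD bF' bG' h2).trans ?_
    have : C * D * err K m ≤ C * D * (δ / (4 * (C * D + 1))) := by gcongr
    refine this.trans ?_
    rw [mul_div_assoc', div_le_div_iff₀ (by positivity) (by positivity)]
    nlinarith
  refine ⟨max M1 (max M2 M3), fun m hm m' hm' => ?_⟩
  simp only [ge_iff_le, max_le_iff] at hm hm'
  have k1 := key m hm.2.2
  have k2 := key m' hm'.2.2
  have k3 := hM1 m hm.1 m' hm'.1
  have k4 := hM2 m hm.2.1 m' hm'.2.1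
  rw [abs_le] at *
  constructor <;> linarith [k1.1, k1.2, k2.1, k2.2, k3.1, k3.2, k4.1, k4.2]

/-- the oscillation -/
noncomputable def osc (F : ℝ⟦X⟧) : ℝ := sInf {a | 0 ≤ a ∧ OscLe F a}

lemma osc_nonneg (F : ℝ⟦X⟧) : 0 ≤ osc F := Real.sInf_nonneg fun _ h => h.1

lemma osc_le {F : ℝ⟦X⟧} {a : ℝ} (ha : 0 ≤ a) (h : OscLe F a) : osc F ≤ a :=
  csInf_le ⟨0, fun _ h => h.1⟩ ⟨ha, h⟩

lemma Bd.oscLe {F : ℝ⟦X⟧} (h : Bd F) : OscLe F (osc F) := by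
  obtain ⟨C, hC, h⟩ := h
  have hne : {a | 0 ≤ a ∧ OscLe F a}.Nonempty := by
    refine ⟨C + C, by positivity, fun δ hδ => ⟨0, fun m _ m' _ => ?_⟩⟩
    have h1 := Bd.nv_le h m
    have h2 := Bd.nv_le h m'
    rw [abs_le] at *
    constructor <;> linarith [h1.1, h1.2, h2.1, h2.2]
  intro δ hδ
  obtain ⟨a, ⟨_, ha⟩, hlt⟩ := Real.lt_sInf_add_pos hne (half_pos hδ)
  obtain ⟨M, hM⟩ := ha (δ / 2) (half_pos hδ)
  refine ⟨M, fun m hm m' hm' => (hM m hm m' hm').trans ?_⟩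
  unfold osc
  linarith

end Sub



namespace Sub
open Filter Topology PowerSeries

lemma Lim.add {F G : ℝ⟦X⟧} {a b : ℝ} (hF : Lim F a) (hG : Lim G b) : Lim (F + G) (a + b) := by
  refine (Tendsto.add hF hG).congr fun m => (nv_add F G m).symm

lemma Lim.smul {F : ℝ⟦X⟧} {a : ℝ} (hF : Lim F a) (r : ℝ) : Lim (C r * F) (r * a) := by
  refine (Tendsto.const_mul r hF).congr fun m => ?_
  simp [nv, coeff_C_mul, mul_div_assoc]

lemma ev_smul {F : ℝ⟦X⟧} (r : ℝ) : ev (C r * F) = r * ev F := by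
  simp only [ev, coeff_C_mul, tsum_mul_left]

lemma lim_C (r : ℝ) : Lim (C r) 0 :=
  lim_of_zero (N := 1) fun m hm => by rw [coeff_C, if_neg (by omega)]

lemma ev_C (r : ℝ) : ev (C r) = r := by
  unfold ev
  simp_rw [coeff_C]
  exact tsum_ite_eq 0 _

lemma lim_one : Lim 1 0 :=
  lim_of_zero (N := 1) fun m hm => by rw [coeff_one, if_neg (by omega)]

lemma ev_one : ev 1 = 1 := by
  unfold ev
  simp_rw [coeff_one]
  exact tsum_ite_eq 0 _

lemma lim_X_pow (k : ℕ) : Lim (X ^ k) 0 :=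
  lim_of_zero (N := k + 1) fun m hm => by rw [coeff_X_pow, if_neg (by omega)]

lemma ev_X_pow (k : ℕ) : ev (X ^ k) = 1 := by
  unfold ev
  simp_rw [coeff_X_pow]
  exact tsum_ite_eq k _

lemma lim_X : Lim X 0 := by simpa using lim_X_pow 1
lemma ev_X : ev X = 1 := by simpa using ev_X_pow 1

lemma lim_CX (r : ℝ) : Lim (C r * X) 0 := by simpa using lim_X.smul r
lemma ev_CX (r : ℝ) : ev (C r * X) = r := by rw [ev_smul, ev_X, mul_one]

/-- shifting -/
lemma Lim.shift {F : ℝ⟦X⟧} {l : ℝ} (h : Lim F l) (r : ℝ) (d : ℕ) : Lim (C r * (X ^ d * F)) (r * l) := by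
  have := (lim_mul (lim_X_pow d) h).smul r
  simpa [ev_X_pow] using this

/-- Catalan generating function -/
noncomputable def CF : ℝ⟦X⟧ := PowerSeries.mk cc
/-- square root of one minus X -/
noncomputable def rt : ℝ⟦X⟧ := 1 + C (-1 / 2 : ℝ) * (X * CF)

lemma CF_eq : X * (CF * CF) = C 4 * (CF - 1) := by
  ext m
  cases m with
  | zero => simp [CF, cc]
  | succ m =>
    rw [coeff_succ_X_mul, coeff_mul]
    simp only [CF, coeff_mk, cc_conv, coeff_C_mul, map_sub, coeff_one]
    simp

lemma C_eq_helper (a b : ℝ) : (C a : ℝ⟦X⟧) * C b = C (a * b) := (map_mul _ _ _).symm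

lemma rt_sq : rt * rt = 1 - X := by
  unfold rt
  have h := CF_eq
  have h1 : (C (-1 / 2 : ℝ) : ℝ⟦X⟧) * C 4 = -2 := by
    rw [C_eq_helper]; norm_num
    exact map_ofNat (C : ℝ →+* ℝ⟦X⟧) 2
  have h2 : (C (-1 / 2 : ℝ) : ℝ⟦X⟧) * 2 = -1 := by
    rw [← map_ofNat (C : ℝ →+* ℝ⟦X⟧) 2, C_eq_helper]; norm_num
  linear_combination C (-1/2 : ℝ) ^ 2 * X * h + X * CF * h2 + (C (-1 / 2 : ℝ)) * X * (CF - 1) * h1 - X * (CF - 1) * h2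

lemma lim_CF : Lim CF 1 := by
  refine tendsto_const_nhds.congr fun m => ?_
  simp [nv, CF, div_self (cc_ne m)]

lemma lim_rt : Lim rt (-1 / 2) := by
  have := lim_one.add (lim_CF.shift (-1 / 2) 1)
  simpa [rt] using this

lemma ev_rt : ev rt = 0 := by
  have h := ev_mul lim_rt.bd lim_rt.bd
  rw [rt_sq, sub_eq_add_neg, ← neg_one_mul] at h
  have e : (-1 : ℝ⟦X⟧) = C (-1 : ℝ) := by simp
  rw [e, ev_add lim_one.bd (lim_CX _).bd, ev_one, ev_CX] at h
  nlinarith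

lemma rtk_lim {κ : ℝ} (h : |κ| < 1) : Lim (rescale κ rt) 0 := by
  have h1 : Tendsto (fun m : ℕ => κ ^ m) atTop (𝓝 0) := tendsto_pow_atTop_nhds_zero_of_abs_lt_one h
  have := h1.mul lim_rt
  rw [zero_mul] at this
  refine this.congr fun m => ?_
  simp [nv, coeff_rescale, mul_div_assoc]

lemma rtk_sq (κ : ℝ) : rescale κ rt * rescale κ rt = 1 - C κ * X := by
  rw [← map_mul, rt_sq, map_sub, map_one, rescale_X]

lemma ev_rtk {κ : ℝ} (h : |κ| < 1) : ev (rescale κ rt) ≠ 0 := by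
  have h1 := ev_mul (rtk_lim h).bd (rtk_lim h).bd
  rw [rtk_sq] at h1
  have e : (1 : ℝ⟦X⟧) - C κ * X = 1 + C (-κ) * X := by rw [map_neg]; ring
  rw [e, ev_add lim_one.bd (lim_CX _).bd, ev_one, ev_CX] at h1
  intro h0
  rw [h0] at h1
  have := (abs_lt.1 h).2
  linarith

/-- geometric series -/
noncomputable def geo (r : ℝ) : ℝ⟦X⟧ := PowerSeries.mk fun m => r ^ m

lemma geo_mul (r : ℝ) : (1 - C r * X) * geo r = 1 := by
  ext m
  rw [sub_mul, one_mul, mul_assoc, map_sub, coeff_C_mul]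
  cases m with
  | zero => simp [geo]
  | succ m => 
    rw [coeff_succ_X_mul, coeff_one]
    simp [geo, pow_succ, mul_comm]

lemma lim_geo {r : ℝ} (h : |r| < 1 / 4) : Lim (geo r) 0 := by
  have h1 : Tendsto (fun m : ℕ => (4 * |r|) ^ m) atTop (𝓝 0) :=
    tendsto_pow_atTop_nhds_zero_of_lt_one (by positivity) (by linarith)
  refine squeeze_zero_norm (fun m => ?_) h1
  rw [nv, geo, coeff_mk, Real.norm_eq_abs, abs_div, abs_of_pos (cc_pos m), abs_pow,
    div_le_iff₀ (cc_pos m)]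
  calc |r| ^ m = (4 * |r|) ^ m * (1 / 4) ^ m := by rw [← mul_pow]; congr 1; ring
    _ ≤ _ := by gcongr; exact cc_ge m

theorem U_asymp {s ρ : ℝ} (hs : 0 < s) (hs2 : 2 ≤ s ^ 2) (hρ : ρ = 1 / (s ^ 2 + 2 * s)) {U : ℝ⟦X⟧}
    (h0 : coeff 0 U = 0) (hnn : ∀ m, 0 ≤ coeff m U)
    (hq : (1 + C ρ * X) * (U * U) + C (s ^ 2 * ρ) * X = (1 + C (s ^ 2 * ρ) * X) * U) :
    ∃ l, 0 < l ∧ Lim U l ∧ ev U = s / (1 + s) := by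
  have hs1 : 1 < s := by nlinarith
  have hρ0 : 0 < ρ := by rw [hρ]; positivity
  have hρ4 : ρ < 1 / 4 := by
    rw [hρ]; gcongr; linarith
  set κ : ℝ := (s - 2) / (s + 2) with hκ
  have hκ1 : |κ| < 1 := by
    rw [hκ, abs_div, abs_of_pos (by linarith : 0 < s + 2), div_lt_one (by linarith), abs_lt]
    constructor <;> linarith
  set y : ℝ⟦X⟧ := 1 + C (s ^ 2 * ρ) * X - 2 * ((1 + C ρ * X) * U) with hy
  have hc1 : 1 + κ = 2 * (s ^ 2 * ρ) := by rw [hκ, hρ]; field_simp; ring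
  have hc2 : κ = (s ^ 2 * ρ) ^ 2 - 4 * (s ^ 2 * ρ * ρ) := by rw [hκ, hρ]; field_simp; ring
  have e1 : (1 : ℝ⟦X⟧) + C κ = 2 * C (s ^ 2 * ρ) := by
    rw [← map_one (C : ℝ →+* ℝ⟦X⟧), ← map_add, hc1, map_mul, map_ofNat]
  have e2 : (C κ : ℝ⟦X⟧) = C (s ^ 2 * ρ) ^ 2 - 4 * (C (s ^ 2 * ρ) * C ρ) := by
    rw [hc2, map_sub, map_pow, map_mul (C : ℝ →+* ℝ⟦X⟧) 4, map_ofNat, map_mul _ (s ^ 2 * ρ) ρ]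
  have ysq : y * y = (rt * rescale κ rt) * (rt * rescale κ rt) := by
    have : (rt * rescale κ rt) * (rt * rescale κ rt) = (1 - X) * (1 - C κ * X) := by
      rw [← rt_sq, ← rtk_sq]; ring
    rw [this, hy]
    linear_combination 4 * (1 + C ρ * X) * hq + X * e1 - X ^ 2 * e2
  have y0 : coeff 0 y = 1 := by
    simp only [hy, map_sub, map_add, coeff_zero_eq_constantCoeff, map_mul, constantCoeff_X]
    rw [← coeff_zero_eq_constantCoeff_apply U, h0]; simp
  have rt0 : constantCoeff rt = 1 := by simp [rt]
  have rtk0 : constantCoeff (rescale κ rt) = 1 := by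
    rw [← coeff_zero_eq_constantCoeff_apply, coeff_rescale]; simp [rt0]
  have hy2 : y = rt * rescale κ rt := by
    have : (y - rt * rescale κ rt) * (y + rt * rescale κ rt) = 0 := by
      linear_combination ysq
    rcases mul_eq_zero.1 this with h | h
    · exact sub_eq_zero.1 h
    · exfalso
      have := congrArg (coeff 0) h
      rw [map_add, y0] at this
      simp [rt0, rtk0] at this
  have ly := lim_mul lim_rt (rtk_lim hκ1)
  rw [← hy2, ev_rt] at ly
  have lg : Lim (geo (-ρ)) 0 := lim_geo (by rw [abs_neg, abs_of_pos hρ0]; exact hρ4)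
  have gm := geo_mul (-ρ)
  have eg : ev (geo (-ρ)) ≠ 0 := by
    have h1 : (1 : ℝ⟦X⟧) - C (-ρ) * X = 1 + C ρ * X := by rw [map_neg]; ring
    rw [h1] at gm
    have := ev_mul (lim_one.add (lim_CX ρ)).bd lg.bd
    rw [gm, ev_one] at this
    intro h; rw [h] at this; simp at this
  have h2 : (C (1 / 2 : ℝ) : ℝ⟦X⟧) * 2 = 1 := by
    rw [← map_ofNat (C : ℝ →+* ℝ⟦X⟧) 2, C_eq_helper]; norm_num
  have hU : U = C (1 / 2 : ℝ) * (geo (-ρ) * (1 + C (s ^ 2 * ρ) * X + C (-1) * y)) := by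
    rw [map_neg, neg_mul, sub_neg_eq_add] at gm
    rw [hy, map_neg, map_one]
    linear_combination (-U) * h2 - C (1 / 2 : ℝ) * 2 * U * gm
  have lU := (lim_mul lg ((lim_one.add (lim_CX (s ^ 2 * ρ))).add (ly.smul (-1)))).smul (1 / 2)
  rw [← hU] at lU
  set l := 1 / 2 * (ev (geo (-ρ)) *
    (0 + 0 + -1 * (0 * 0 + ev ((rescale κ) rt) * (-1 / 2))) +
    ev (1 + C (s ^ 2 * ρ) * X + C (-1) * y) * 0) with hl
  have lne : l ≠ 0 := by
    have := ev_rtk hκ1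
    have e : l = ev (geo (-ρ)) * ev (rescale κ rt) / 4 := by rw [hl]; ring
    rw [e]
    positivity
  have lnn : 0 ≤ l := ge_of_tendsto' lU fun m => div_nonneg (hnn m) (cc_pos m).le
  refine ⟨l, lnn.lt_of_ne' lne, lU, ?_⟩
  have bU := lU.bd
  have b1 : Bd (1 + C ρ * X) := (lim_one.add (lim_CX ρ)).bd
  have b2 : Bd (1 + C (s ^ 2 * ρ) * X) := (lim_one.add (lim_CX _)).bd
  have E := congrArg ev hq
  rw [ev_add (b1.mul (bU.mul bU)) (lim_CX _).bd, ev_mul b1 (bU.mul bU), ev_mul bU bU, ev_mul b2 bU,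
    ev_add lim_one.bd (lim_CX _).bd, ev_add lim_one.bd (lim_CX _).bd, ev_one, ev_CX, ev_CX] at E
  have E2 : (1 + ρ) * (ev U - s / (1 + s)) ^ 2 = 0 := by
    have e3 : 2 * ((1 + ρ) * (s / (1 + s))) = 1 + s ^ 2 * ρ := by rw [hρ]; field_simp; ring
    have e4 : (1 + ρ) * (s / (1 + s)) ^ 2 = s ^ 2 * ρ := by rw [hρ]; field_simp; ring
    linear_combination E - ev U * e3 + e4
  have := (mul_eq_zero.1 E2).resolve_left (by positivity)
  nlinarith [pow_eq_zero_iff (two_ne_zero) |>.1 this]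

end Sub



open AT

namespace Sub
open Filter Topology PowerSeries

/-- types with a size function with finite fibres -/
class Sized (Y : Type*) where
  sz : Y → ℕ
  fin : ∀ m, {y | sz y = m}.Finite

/-- objects of given size -/
noncomputable def fib (Y : Type*) [Sized Y] (m : ℕ) : Finset Y := (Sized.fin (Y := Y) m).toFinset

lemma mem_fib {Y : Type*} [Sized Y] {m : ℕ} {y : Y} : y ∈ fib Y m ↔ Sized.sz y = m := by
  simp [fib]

/-- weighted generating function -/
noncomputable def gw {Y : Type*} [Sized Y] (ρ : ℝ) (φ : Y → ℝ) : ℝ⟦X⟧ :=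
  PowerSeries.mk fun m => ρ ^ m * ∑ y ∈ fib Y m, φ y

open Classical in
/-- indicator -/
noncomputable def ind (P : Prop) : ℝ := if P then 1 else 0

lemma ind_nonneg (P : Prop) : 0 ≤ ind P := by unfold ind; split_ifs <;> norm_num
lemma ind_mono {P Q : Prop} (h : P → Q) : ind P ≤ ind Q := by
  by_cases hP : P
  · simp [ind, hP, h hP]
  · simpa [ind, hP] using ind_nonneg Q
lemma ind_true {P : Prop} (h : P) : ind P = 1 := by simp [ind, h]
lemma ind_false {P : Prop} (h : ¬ P) : ind P = 0 := by simp [ind, h]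

variable {Y Z : Type*} [Sized Y] [Sized Z]

lemma coeff_gw (ρ : ℝ) (φ : Y → ℝ) (m : ℕ) : coeff m (gw ρ φ) = ρ ^ m * ∑ y ∈ fib Y m, φ y := by
  simp [gw]

lemma gw_add (ρ : ℝ) (φ ψ : Y → ℝ) : gw ρ (fun y => φ y + ψ y) = gw ρ φ + gw ρ ψ := by
  ext m
  simp only [coeff_gw, map_add, Finset.sum_add_distrib, mul_add]

lemma gw_sum {ι : Type*} (ρ : ℝ) (s : Finset ι) (φ : ι → Y → ℝ) :
    gw ρ (fun y => ∑ i ∈ s, φ i y) = ∑ i ∈ s, gw ρ (φ i) := by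
  ext m
  rw [map_sum]
  simp only [coeff_gw]
  rw [Finset.sum_comm, Finset.mul_sum]

lemma gw_mono {ρ : ℝ} (hρ : 0 ≤ ρ) {φ ψ : Y → ℝ} (h : ∀ y, φ y ≤ ψ y) (m : ℕ) :
    coeff m (gw ρ φ) ≤ coeff m (gw ρ ψ) := by
  rw [coeff_gw, coeff_gw]
  gcongr
  exact h _

lemma gw_nonneg {ρ : ℝ} (hρ : 0 ≤ ρ) {φ : Y → ℝ} (h : ∀ y, 0 ≤ φ y) (m : ℕ) :
    0 ≤ coeff m (gw ρ φ) := by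
  rw [coeff_gw]
  exact mul_nonneg (by positivity) (Finset.sum_nonneg fun y _ => h y)

instance : Sized (Y × Z) where
  sz p := Sized.sz p.1 + Sized.sz p.2
  fin m := by
    have h : {p : Y × Z | Sized.sz p.1 + Sized.sz p.2 = m} ⊆
        ⋃ i ∈ Finset.range (m + 1), ⋃ j ∈ Finset.range (m + 1),
          {y : Y | Sized.sz y = i} ×ˢ {z : Z | Sized.sz z = j} := by
      intro p hp
      simp only [Set.mem_ofPred_eq] at hp
      simp only [Set.mem_iUnion, Finset.mem_range]
      exact ⟨Sized.sz p.1, by omega, Sized.sz p.2, by omega, rfl, rfl⟩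
    refine Set.Finite.subset ?_ h
    refine Set.Finite.biUnion (Finset.finite_toSet _) fun i _ => ?_
    refine Set.Finite.biUnion (Finset.finite_toSet _) fun j _ => ?_
    exact (Sized.fin i).prod (Sized.fin j)

lemma gw_prod (ρ : ℝ) (φ : Y → ℝ) (ψ : Z → ℝ) :
    gw ρ (fun p : Y × Z => φ p.1 * ψ p.2) = gw ρ φ * gw ρ ψ := by
  classical
  ext m
  rw [coeff_mul, coeff_gw]
  have hf : fib (Y × Z) m = (Finset.HasAntidiagonal.antidiagonal m).biUnion
      fun ij => fib Y ij.1 ×ˢ fib Z ij.2 := by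
    ext p
    rw [mem_fib]
    simp only [Finset.mem_biUnion, Finset.HasAntidiagonal.mem_antidiagonal, Finset.mem_product, mem_fib]
    constructor
    · intro h
      exact ⟨(Sized.sz p.1, Sized.sz p.2), h, rfl, rfl⟩
    · rintro ⟨ij, h, h1, h2⟩
      rw [← h, ← h1, ← h2]; rfl
  rw [hf, Finset.sum_biUnion, Finset.mul_sum]
  · refine Finset.sum_congr rfl fun ij hij => ?_
    rw [Finset.HasAntidiagonal.mem_antidiagonal] at hij
    rw [Finset.sum_product, coeff_gw, coeff_gw, ← hij, pow_add, mul_mul_mul_comm,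
      Finset.sum_mul_sum]
  · intro a _ b _ hab
    rw [Function.onFun, Finset.disjoint_left]
    intro p hp hp'
    simp only [Finset.mem_product, mem_fib] at hp hp'
    exact hab (Prod.ext (hp.1.symm.trans hp'.1) (hp.2.symm.trans hp'.2))

lemma gw_inj (ρ : ℝ) (e : Y → Z) (he : Function.Injective e) (d : ℕ)
    (hd : ∀ y, Sized.sz (e y) = Sized.sz y + d) (φ : Z → ℝ) (h : ∀ z, φ z ≠ 0 → z ∈ Set.range e) :
    gw ρ φ = C (ρ ^ d) * (X ^ d * gw ρ (fun y => φ (e y))) := by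
  classical
  ext m
  rw [coeff_C_mul, coeff_X_pow_mul', coeff_gw]
  split_ifs with hm
  · rw [coeff_gw, ← mul_assoc, ← pow_add, Nat.add_sub_cancel' hm]
    congr 1
    rw [← Finset.sum_image (s := fib Y (m - d)) (g := e) (f := φ) (fun a _ b _ hab => he hab)]
    symm
    refine Finset.sum_subset ?_ ?_
    · intro z hz
      obtain ⟨y, hy, rfl⟩ := Finset.mem_image.1 hz
      rw [mem_fib] at *
      rw [hd, hy]; omega
    · intro z hz hz'
      by_contra hne
      obtain ⟨y, rfl⟩ := h z hne
      apply hz'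
      refine Finset.mem_image_of_mem _ ?_
      rw [mem_fib] at *
      rw [hd] at hz; omega
  · rw [mul_zero, Finset.sum_eq_zero, mul_zero]
    intro z hz
    by_contra hne
    obtain ⟨y, rfl⟩ := h z hne
    rw [mem_fib, hd] at hz
    omega

/-- partition according to a label -/
lemma gw_part {B : Type*} [Fintype B] (ρ : ℝ) (P : Y → Prop) (a : Y → B) :
    gw ρ (fun y => ind (P y)) = ∑ f, gw ρ (fun y => ind (P y ∧ a y = f)) := by
  classical
  rw [← gw_sum]
  congr 1
  funext y
  rw [Finset.sum_eq_single (a y)]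
  · simp
  · intro f _ hf
    exact ind_false fun h => hf h.2.symm
  · simp

lemma gw_pairs {B : Type*} (ρ : ℝ) (Q : Finset (B × B)) (P : Y → Prop) (R : Z → Prop)
    (a : Y → B) (b : Z → B) :
    gw ρ (fun p : Y × Z => ind (P p.1 ∧ R p.2 ∧ (a p.1, b p.2) ∈ Q)) =
      ∑ q ∈ Q, gw ρ (fun y => ind (P y ∧ a y = q.1)) * gw ρ (fun z => ind (R z ∧ b z = q.2)) := by
  classical
  simp_rw [← gw_prod]
  rw [← gw_sum]
  congr 1
  funext p
  by_cases h : (a p.1, b p.2) ∈ Q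
  · rw [Finset.sum_eq_single_of_mem _ h]
    · unfold ind
      by_cases h1 : P p.1 <;> by_cases h2 : R p.2 <;> simp [h1, h2, h]
    · intro q _ hq
      by_cases h1 : a p.1 = q.1
      · rw [ind_false (P := R p.2 ∧ _), mul_zero]
        rintro ⟨_, h2⟩
        exact hq (Prod.ext h1.symm h2.symm)
      · rw [ind_false (P := P p.1 ∧ _), zero_mul]
        rintro ⟨_, h2⟩
        exact h1 h2
  · rw [ind_false fun h' => h h'.2.2, Finset.sum_eq_zero]
    intro q hq
    by_cases h1 : a p.1 = q.1
    · rw [ind_false (P := R p.2 ∧ _), mul_zero]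
      rintro ⟨_, h2⟩
      exact h (by rw [h1, h2]; exact hq)
    · rw [ind_false (P := P p.1 ∧ _), zero_mul]
      rintro ⟨_, h2⟩
      exact h1 h2

lemma size_pos {n : ℕ} (t : AT n) : 1 ≤ size t := by
  cases t <;> simp [size]

lemma finite_le (n m : ℕ) : {t : AT n | size t ≤ m}.Finite ∧ {ts : List (AT n) | sizeList ts ≤ m}.Finite := by
  induction m with
  | zero =>
    constructor
    · convert Set.finite_empty
      ext t
      have := size_pos t
      simp; omega
    · refine (Set.finite_singleton []).subset ?_
      intro ts h
      cases ts with
      | nil => simp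
      | cons t ts =>
        have := size_pos t
        simp [sizeList] at h
        omega
  | succ m ih =>
    have h1 : {t : AT n | size t ≤ m + 1}.Finite := by
      refine Set.Finite.subset (((Set.finite_range fun p : Fin n × Bool => AT.leaf p.1 p.2)).union
        (Set.Finite.image2 (fun c ts => AT.node c ts) (Set.finite_univ (α := Bool)) ih.2)) ?_
      intro t ht
      cases t with
      | leaf i b => exact Or.inl ⟨(i, b), rfl⟩
      | node c ts =>
        refine Or.inr ⟨c, trivial, ts, ?_, rfl⟩
        simp [size] at ht
        simp; omega
    refine ⟨h1, ?_⟩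
    refine Set.Finite.subset ((Set.finite_singleton []).union
      (Set.Finite.image2 List.cons h1 ih.2)) ?_
    intro ts h
    cases ts with
    | nil => simp
    | cons t ts =>
      have := size_pos t
      simp [sizeList] at h
      refine Or.inr ⟨t, ?_, ts, ?_, rfl⟩ <;> simp <;> omega

instance (n : ℕ) : Sized (AT n) where
  sz := size
  fin m := (finite_le n m).1.subset fun _ h => le_of_eq h

instance (n : ℕ) : Sized (List (AT n)) where
  sz := sizeList
  fin m := (finite_le n m).2.subset fun _ h => le_of_eq h

lemma sz_AT {n : ℕ} (t : AT n) : Sized.sz t = size t := rfl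
lemma sz_list {n : ℕ} (t : List (AT n)) : Sized.sz t = sizeList t := rfl
lemma sz_prod (p : Y × Z) : Sized.sz p = Sized.sz p.1 + Sized.sz p.2 := rfl

mutual
/-- dual tree -/
def dual {n : ℕ} : AT n → AT n
  | .leaf i b => .leaf i (!b)
  | .node c ts => .node (!c) (dualList ts)
/-- dual of a list -/
def dualList {n : ℕ} : List (AT n) → List (AT n)
  | [] => []
  | t :: ts => dual t :: dualList ts
end

mutual
theorem dual_dual {n : ℕ} : ∀ t : AT n, dual (dual t) = t
  | .leaf i b => by simp [dual]
  | .node c ts => by simp [dual, dualList_dualList ts]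
theorem dualList_dualList {n : ℕ} : ∀ t : List (AT n), dualList (dualList t) = t
  | [] => by simp [dualList]
  | t :: ts => by simp [dualList, dual_dual t, dualList_dualList ts]
end

mutual
theorem size_dual {n : ℕ} : ∀ t : AT n, size (dual t) = size t
  | .leaf i b => by simp [dual, size]
  | .node c ts => by simp [dual, size, size_dualList ts]
theorem size_dualList {n : ℕ} : ∀ t : List (AT n), sizeList (dualList t) = sizeList t
  | [] => by simp [dualList]
  | t :: ts => by simp [dualList, sizeList, size_dual t, size_dualList ts]
end

mutual
theorem eval_dual {n : ℕ} (x : Fin n → Bool) : ∀ t : AT n, eval (dual t) x = !(eval t x)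
  | .leaf i b => by cases b <;> simp [dual, eval]
  | .node c ts => by simp [dual, eval, eval_dualList x ts]
theorem eval_dualList {n : ℕ} (x : Fin n → Bool) : ∀ (t : List (AT n)) (c : Bool),
    evalList (!c) (dualList t) x = !(evalList c t x)
  | [], c => by simp [dualList, evalList]
  | t :: ts, c => by
    have h := eval_dualList x ts c
    cases c <;> simp_all [dualList, evalList, eval_dual x t]
end

lemma dualList_eq {n : ℕ} (ts : List (AT n)) : dualList ts = ts.map dual := by
  induction ts with
  | nil => simp [dualList]
  | cons t ts ih => simp [dualList, ih]

lemma root_dual {n : ℕ} (t : AT n) : rootConn (dual t) = (rootConn t).map (!·) := by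
  cases t <;> simp [dual, rootConn]

lemma root_dual_iff {n : ℕ} (t : AT n) (c : Bool) : rootConn (dual t) = some c ↔ rootConn t = some (!c) := by
  cases t with
  | leaf => simp [dual, rootConn]
  | node d ts => cases c <;> cases d <;> simp [dual, rootConn]

lemma wf_dual {n : ℕ} {t : AT n} (h : WF t) : WF (dual t) := by
  induction h with
  | leaf i b => exact WF.leaf _ _
  | node c ts h1 h2 h3 ih =>
    rw [dual, dualList_eq]
    refine WF.node _ _ (by simpa using h1) ?_ ?_
    · intro t ht
      obtain ⟨t', ht', rfl⟩ := List.mem_map.1 ht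
      exact ih t' ht'
    · intro t ht
      obtain ⟨t', ht', rfl⟩ := List.mem_map.1 ht
      rw [Ne, root_dual_iff, Bool.not_not]
      exact h3 t' ht'

lemma wf_dual_iff {n : ℕ} {t : AT n} : WF (dual t) ↔ WF t :=
  ⟨fun h => by simpa [dual_dual] using wf_dual h, wf_dual⟩

lemma gw_dual {n : ℕ} (ρ : ℝ) (φ : AT n → ℝ) : gw ρ φ = gw ρ (fun t => φ (dual t)) := by
  have := gw_inj ρ (dual (n := n)) (fun a b h => by rw [← dual_dual a, h, dual_dual]) 0
    (fun t => by rw [sz_AT, sz_AT, size_dual]; rfl) φ (fun t _ => ⟨dual t, dual_dual t⟩)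
  simpa using this

end Sub



open AT

namespace Sub
open Filter Topology PowerSeries

/-- Boolean functions -/
abbrev BF (n : ℕ) := (Fin n → Bool) → Bool

/-- children of a node with connective c -/
def inU {n : ℕ} (c : Bool) (t : AT n) : Prop := WF t ∧ rootConn t ≠ some c
/-- lists of children of a node with connective c -/
def inL {n : ℕ} (c : Bool) (ts : List (AT n)) : Prop := ∀ t ∈ ts, inU c t
/-- pointwise connective -/
def star {n : ℕ} (c : Bool) (g h : BF n) : BF n := fun x => if c then g x && h x else g x || h x

noncomputable def Uf (n : ℕ) (ρ : ℝ) (c : Bool) (f : BF n) : ℝ⟦X⟧ :=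
  gw ρ (fun t : AT n => ind (inU c t ∧ eval t = f))
noncomputable def Lf (n : ℕ) (ρ : ℝ) (c : Bool) (f : BF n) : ℝ⟦X⟧ :=
  gw ρ (fun ts : List (AT n) => ind (inL c ts ∧ evalList c ts = f))
noncomputable def Lpf (n : ℕ) (ρ : ℝ) (c : Bool) (f : BF n) : ℝ⟦X⟧ :=
  gw ρ (fun ts : List (AT n) => ind ((inL c ts ∧ ts ≠ []) ∧ evalList c ts = f))
noncomputable def Nf (n : ℕ) (ρ : ℝ) (c : Bool) (f : BF n) : ℝ⟦X⟧ :=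
  gw ρ (fun t : AT n => ind ((WF t ∧ rootConn t = some c) ∧ eval t = f))
noncomputable def litf (n : ℕ) (ρ : ℝ) (f : BF n) : ℝ⟦X⟧ :=
  gw ρ (fun t : AT n => ind (rootConn t = none ∧ eval t = f))

noncomputable def Ut (n : ℕ) (ρ : ℝ) (c : Bool) : ℝ⟦X⟧ := gw ρ (fun t : AT n => ind (inU c t))
noncomputable def Lt (n : ℕ) (ρ : ℝ) (c : Bool) : ℝ⟦X⟧ := gw ρ (fun t : List (AT n) => ind (inL c t))
noncomputable def Lpt (n : ℕ) (ρ : ℝ) (c : Bool) : ℝ⟦X⟧ :=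
  gw ρ (fun ts : List (AT n) => ind (inL c ts ∧ ts ≠ []))
noncomputable def Nt (n : ℕ) (ρ : ℝ) (c : Bool) : ℝ⟦X⟧ :=
  gw ρ (fun t : AT n => ind (WF t ∧ rootConn t = some c))

variable {n : ℕ} {ρ : ℝ} {c : Bool}

lemma Ut_eq : Ut n ρ c = ∑ f, Uf n ρ c f := gw_part _ _ _
lemma Lt_eq : Lt n ρ c = ∑ f, Lf n ρ c f := gw_part _ _ _
lemma Lpt_eq : Lpt n ρ c = ∑ f, Lpf n ρ c f := gw_part _ _ _
lemma Nt_eq : Nt n ρ c = ∑ f, Nf n ρ c f := gw_part _ _ _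

lemma inL_cons {t : AT n} {ts : List (AT n)} : inL c (t :: ts) ↔ inU c t ∧ inL c ts := by
  simp [inL]

lemma evalList_cons (t : AT n) (ts : List (AT n)) :
    evalList c (t :: ts) = star c (eval t) (evalList c ts) := by
  funext x; simp [evalList, star]

lemma wf_node {ts : List (AT n)} : WF (.node c ts) ↔ 2 ≤ ts.length ∧ inL c ts := by
  constructor
  · rintro (_ | ⟨_, _, h1, h2, h3⟩)
    exact ⟨h1, fun t ht => ⟨h2 t ht, h3 t ht⟩⟩
  · rintro ⟨h1, h2⟩
    exact WF.node _ _ h1 (fun t ht => (h2 t ht).1) fun t ht => (h2 t ht).2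

open Classical in
lemma Lf_eq (f : BF n) : Lf n ρ c f = C (ind ((fun _ => c) = f)) + Lpf n ρ c f := by
  have h : ∀ ts : List (AT n), ind (inL c ts ∧ evalList c ts = f)
      = ind (ts = [] ∧ (fun _ => c) = f) + ind ((inL c ts ∧ ts ≠ []) ∧ evalList c ts = f) := by
    intro ts
    cases ts with
    | nil =>
      have : evalList c ([] : List (AT n)) = fun _ => c := by funext x; simp [evalList]
      simp [ind, inL, this]
    | cons t ts => simp [ind]
  unfold Lf Lpf
  simp_rw [h]
  rw [gw_add]
  congr 1
  ext m
  rw [coeff_gw, coeff_C]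
  by_cases hm : m = 0
  · subst hm
    have : fib (List (AT n)) 0 = {[]} := by
      ext ts
      rw [mem_fib, sz_list, Finset.mem_singleton]
      cases ts with
      | nil => simp [sizeList]
      | cons t ts =>
        have := size_pos t
        simp [sizeList]; omega
    rw [this]
    simp
  · rw [if_neg hm, Finset.sum_eq_zero, mul_zero]
    intro ts hts
    rw [mem_fib, sz_list] at hts
    refine ind_false fun h => hm ?_
    rw [← hts, h.1]; simp [sizeList]

/-- pairs with given product -/
noncomputable def fibre (n : ℕ) (c : Bool) (f : BF n) : Finset (BF n × BF n) :=
  open Classical in Finset.univ.filter fun q => star c q.1 q.2 = f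

lemma mem_fibre {f : BF n} {q : BF n × BF n} : q ∈ fibre n c f ↔ star c q.1 q.2 = f := by
  simp [fibre]

lemma Lpf_eq (f : BF n) : Lpf n ρ c f = ∑ q ∈ fibre n c f, Uf n ρ c q.1 * Lf n ρ c q.2 := by
  have h1 := gw_pairs ρ (fibre n c f) (inU (n := n) c) (inL c) eval (evalList c)
  unfold Uf Lf
  rw [← h1]
  unfold Lpf
  rw [gw_inj ρ (fun p : AT n × List (AT n) => p.1 :: p.2) ?_ 0 ?_]
  · simp only [pow_zero, map_one, one_mul]
    congr 1
    funext p
    congr 1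
    rw [inL_cons, mem_fibre, evalList_cons]
    simp [and_assoc]
  · intro ts hts
    cases ts with
    | nil => simp [ind] at hts
    | cons t ts => exact ⟨(t, ts), rfl⟩
  · intro p q h
    simp only [List.cons.injEq] at h
    exact Prod.ext h.1 h.2
  · intro p; rfl

lemma Nf_eq (f : BF n) :
    Nf n ρ c f = C ρ * (X * ∑ q ∈ fibre n c f, Uf n ρ c q.1 * Lpf n ρ c q.2) := by
  have h1 := gw_pairs ρ (fibre n c f) (inU (n := n) c) (fun ts => inL c ts ∧ ts ≠ []) eval (evalList c)
  unfold Uf Lpf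
  rw [← h1]
  unfold Nf
  rw [gw_inj ρ (fun p : AT n × List (AT n) => AT.node c (p.1 :: p.2)) ?_ 1 ?_]
  · rw [pow_one, pow_one]
    congr 3
    funext p
    congr 1
    rw [wf_node, inL_cons, mem_fibre]
    have : eval (AT.node c (p.1 :: p.2)) = star c (eval p.1) (evalList c p.2) := by
      rw [← evalList_cons]; funext x; simp [eval]
    rw [this]
    have h2 : 2 ≤ (p.1 :: p.2).length ↔ p.2 ≠ [] := by
      cases p.2 <;> simp
    rw [h2]
    simp only [rootConn, and_true, eq_iff_iff]
    tauto
  · intro t ht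
    have : (WF t ∧ rootConn t = some c) ∧ eval t = f := by
      by_contra h
      exact ht (ind_false h)
    obtain ⟨⟨hw, h2⟩, h3⟩ := this
    cases t with
    | leaf => simp [rootConn] at h2
    | node d ts =>
      simp only [rootConn, Option.some.injEq] at h2
      subst h2
      rw [wf_node] at hw
      cases ts with
      | nil => simp at hw
      | cons t ts => exact ⟨(t, ts), rfl⟩
  · intro p q h
    simp only [AT.node.injEq, List.cons.injEq, true_and] at h
    exact Prod.ext h.1 h.2
  · intro p
    rw [sz_prod, sz_list, sz_AT, sz_AT]
    simp [size, sizeList]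
    omega

lemma inU_iff (t : AT n) : inU c t ↔ (rootConn t = none ∨ (WF t ∧ rootConn t = some (!c))) := by
  cases t with
  | leaf i b => simp [inU, rootConn, WF.leaf]
  | node d ts => cases c <;> cases d <;> simp [inU, rootConn]

lemma Uf_eq (f : BF n) : Uf n ρ c f = litf n ρ f + Nf n ρ (!c) f := by
  unfold Uf litf Nf
  rw [← gw_add]
  congr 1
  funext t
  rw [inU_iff]
  by_cases h : rootConn t = none
  · simp [ind, h]
  · rw [ind_false (P := rootConn t = none ∧ _) (fun h' => h h'.1), zero_add]
    congr 1
    apply propext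
    tauto

lemma lit_size {t : AT n} (h : rootConn t = none) : size t = 1 := by
  cases t with
  | leaf => simp [size]
  | node => simp [rootConn] at h

lemma litf_coeff (f : BF n) {m : ℕ} (hm : 2 ≤ m) : coeff m (litf n ρ f) = 0 := by
  unfold litf
  rw [coeff_gw, Finset.sum_eq_zero, mul_zero]
  intro t ht
  refine ind_false fun h => ?_
  rw [mem_fib, sz_AT, lit_size h.1] at ht
  omega

lemma litf_lim (f : BF n) : Lim (litf n ρ f) 0 := lim_of_zero (N := 2) fun _ hm => litf_coeff f hm

lemma lit_sum : ∑ f, litf n ρ f = C (2 * n * ρ) * X := by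
  unfold litf
  rw [← gw_part]
  ext m
  rw [coeff_gw, coeff_C_mul, coeff_X]
  split_ifs with hm
  · subst hm
    classical
    have : ∑ t ∈ fib (AT n) 1, ind (rootConn t = none)
        = ∑ t ∈ Finset.univ.image (fun p : Fin n × Bool => AT.leaf p.1 p.2), (1 : ℝ) := by
      symm
      rw [Finset.sum_congr rfl (g := fun t : AT n => ind (rootConn t = none))]
      · refine Finset.sum_subset ?_ ?_
        · intro t ht
          obtain ⟨p, _, rfl⟩ := Finset.mem_image.1 ht
          rw [mem_fib, sz_AT]; simp [size]
        · intro t _ ht'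
          refine ind_false fun h => ht' ?_
          cases t with
          | leaf i b => exact Finset.mem_image.2 ⟨(i, b), by simp, rfl⟩
          | node => simp [rootConn] at h
      · intro t ht
        obtain ⟨p, _, rfl⟩ := Finset.mem_image.1 ht
        simp [ind, rootConn]
    rw [this, Finset.sum_const, Finset.card_image_of_injective]
    · simp; ring
    · intro p q h
      simp only [AT.leaf.injEq] at h
      exact Prod.ext h.1 h.2
  · rw [Finset.sum_eq_zero, mul_zero, mul_zero]
    intro t ht
    refine ind_false fun h => hm ?_
    rw [mem_fib, sz_AT, lit_size h] at ht
    exact ht.symm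

lemma sum_fibre {M : Type*} [AddCommMonoid M] (φ : BF n × BF n → M) :
    ∑ f, ∑ q ∈ fibre n c f, φ q = ∑ q, φ q := by
  classical
  unfold fibre
  convert Finset.sum_fiberwise Finset.univ (fun q : BF n × BF n => star c q.1 q.2) φ

lemma sum_fibre_mul (a b : BF n → ℝ⟦X⟧) :
    ∑ f, ∑ q ∈ fibre n c f, a q.1 * b q.2 = (∑ f, a f) * ∑ f, b f := by
  rw [sum_fibre (fun q => a q.1 * b q.2), Finset.sum_mul_sum, ← Finset.sum_product']
  rfl

lemma Lt_tot : Lt n ρ c = 1 + Lpt n ρ c := by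
  rw [Lt_eq, Lpt_eq, Finset.sum_congr rfl fun f _ => Lf_eq f, Finset.sum_add_distrib]
  congr 1
  rw [Finset.sum_eq_single (fun _ => c)]
  · simp [ind]
  · intro f _ hf
    rw [ind_false hf.symm, map_zero]
  · simp

lemma Lpt_tot : Lpt n ρ c = Ut n ρ c * Lt n ρ c := by
  rw [Lpt_eq, Finset.sum_congr rfl fun f _ => Lpf_eq f, sum_fibre_mul, Lt_eq, Ut_eq]

lemma Nt_tot : Nt n ρ c = C ρ * (X * (Ut n ρ c * Lpt n ρ c)) := by
  rw [Nt_eq, Finset.sum_congr rfl fun f _ => Nf_eq f, ← Finset.mul_sum, ← Finset.mul_sum,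
    sum_fibre_mul, Lpt_eq, Ut_eq]

lemma Ut_tot : Ut n ρ c = C (2 * n * ρ) * X + Nt n ρ (!c) := by
  rw [Ut_eq, Finset.sum_congr rfl fun f _ => Uf_eq f, Finset.sum_add_distrib, lit_sum, Nt_eq]

lemma inU_dual {t : AT n} : inU c (dual t) ↔ inU (!c) t := by
  unfold inU; rw [wf_dual_iff, Ne, root_dual_iff]

lemma Ut_dual : Ut n ρ (!c) = Ut n ρ c := by
  unfold Ut
  rw [gw_dual ρ (fun t : AT n => ind (inU c t))]
  simp_rw [inU_dual]

lemma Nt_dual : Nt n ρ (!c) = Nt n ρ c := by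
  unfold Nt
  rw [gw_dual ρ (fun t : AT n => ind (WF t ∧ rootConn t = some c))]
  simp_rw [wf_dual_iff, root_dual_iff]

lemma quad : (1 + C ρ * X) * (Ut n ρ c * Ut n ρ c) + C (2 * n * ρ) * X
    = (1 + C (2 * n * ρ) * X) * Ut n ρ c := by
  have h1 := Lt_tot (n := n) (ρ := ρ) (c := c)
  have h2 := Lpt_tot (n := n) (ρ := ρ) (c := c)
  have h3 := Nt_tot (n := n) (ρ := ρ) (c := c)
  have h4 := Ut_tot (n := n) (ρ := ρ) (c := c)
  rw [Nt_dual] at h4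
  set U := Ut n ρ c
  set L := Lt n ρ c
  set N := Nt n ρ c
  set P := Lpt n ρ c
  have h5 : L * (1 - U) = 1 := by linear_combination h1 + h2
  have h6 : U = C (2 * n * ρ) * X + C ρ * X * (U * U * L) := by
    linear_combination h4 + h3 + C ρ * X * U * h2
  linear_combination (-(1 - U)) * h6 - C ρ * X * U * U * h5

end Sub



open AT

namespace Sub
open Filter Topology PowerSeries

/-- parameters -/
structure Par (n : ℕ) (s ρ : ℝ) : Prop where
  hn : 1 ≤ n
  hs : 0 < s
  hs2 : s ^ 2 = 2 * n
  hρ : ρ = 1 / (s ^ 2 + 2 * s)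

variable {n : ℕ} {ρ s : ℝ} {c : Bool}

lemma Par.two_le (h : Par n s ρ) : 2 ≤ s ^ 2 := by
  have : (1 : ℝ) ≤ n := by exact_mod_cast h.hn
  rw [h.hs2]; linarith

lemma Par.ρ_pos (h : Par n s ρ) : 0 < ρ := by
  have := h.hs
  rw [h.hρ]; positivity

lemma Par.ρ_eq (h : Par n s ρ) : ρ * (s ^ 2 + 2 * s) = 1 := by
  have := h.hs
  rw [h.hρ]; field_simp

/-- asymptotics of the total series -/
structure Tot (n : ℕ) (s ρ l : ℝ) : Prop where
  l_pos : 0 < l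
  limU : ∀ c, Lim (Ut n ρ c) l
  evU : ∀ c, ev (Ut n ρ c) = s / (1 + s)
  limN : ∀ c, Lim (Nt n ρ c) l
  limP : ∀ c, Lim (Lpt n ρ c) (l * (1 + s) ^ 2)
  limL : ∀ c, Lim (Lt n ρ c) (l * (1 + s) ^ 2)
  evL : ∀ c, ev (Lt n ρ c) = 1 + s
  evP : ∀ c, ev (Lpt n ρ c) = s

lemma Par.tot (h : Par n s ρ) : ∃ l, Tot n s ρ l := by
  have hρ := h.ρ_pos
  have hs := h.hs
  have h0 : coeff 0 (Ut n ρ true) = 0 := by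
    unfold Ut
    rw [coeff_gw, Finset.sum_eq_zero, mul_zero]
    intro t ht
    rw [mem_fib, sz_AT] at ht
    have := size_pos t
    omega
  have hnn : ∀ m, 0 ≤ coeff m (Ut n ρ true) := gw_nonneg hρ.le fun _ => ind_nonneg _
  have hq := quad (n := n) (ρ := ρ) (c := true)
  rw [← h.hs2] at hq
  obtain ⟨l, hl, h1, h2⟩ := U_asymp h.hs h.two_le h.hρ h0 hnn hq
  have hU : ∀ c, Ut n ρ c = Ut n ρ true := by
    intro c; cases c
    · exact Ut_dual (c := true)
    · rfl
  have limU : ∀ c, Lim (Ut n ρ c) l := fun c => by rw [hU]; exact h1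
  have evU : ∀ c, ev (Ut n ρ c) = s / (1 + s) := fun c => by rw [hU]; exact h2
  have limN : ∀ c, Lim (Nt n ρ c) l := fun c => by
    have h3 := Ut_tot (n := n) (ρ := ρ) (c := c)
    rw [Nt_dual] at h3
    have : Nt n ρ c = Ut n ρ c + C (-(2 * n * ρ)) * X := by
      rw [h3, map_neg]; ring
    rw [this]
    simpa using (limU c).add (lim_CX (-(2 * n * ρ)))
  have limP : ∀ c, Lim (Lpt n ρ c) (l * (1 + s) ^ 2) := fun c => by
    have h3 : Nt n ρ c = C ρ * (X * (Lpt n ρ c - Ut n ρ c)) := by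
      rw [Nt_tot]
      have a := Lt_tot (n := n) (ρ := ρ) (c := c)
      have b := Lpt_tot (n := n) (ρ := ρ) (c := c)
      rw [a] at b
      linear_combination (- C ρ * X) * b
    have h4 : ∀ m, nv (Lpt n ρ c) m
        = nv (Nt n ρ c) (m + 1) * (cc (m + 1) / cc m) / ρ + nv (Ut n ρ c) m := by
      intro m
      have h5 : coeff (m + 1) (Nt n ρ c) = ρ * (coeff m (Lpt n ρ c) - coeff m (Ut n ρ c)) := by
        rw [h3, coeff_C_mul, coeff_succ_X_mul, map_sub]
      unfold nv
      rw [h5]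
      have := cc_ne m
      have := cc_ne (m + 1)
      field_simp
      ring
    unfold Lim
    rw [funext h4]
    have h6 : l * (1 + s) ^ 2 = l * 1 / ρ + l := by
      have := h.ρ_eq
      field_simp
      linear_combination this
    rw [h6]
    exact ((((limN c).comp (tendsto_add_atTop_nat 1)).mul cc_ratio).div_const ρ).add (limU c)
  have limL : ∀ c, Lim (Lt n ρ c) (l * (1 + s) ^ 2) := fun c => by
    rw [Lt_tot]
    simpa using lim_one.add (limP c)
  have e1 : ∀ c, ev (Lt n ρ c) = 1 + ev (Lpt n ρ c) := fun c => by
    rw [Lt_tot, ev_add lim_one.bd (limP c).bd, ev_one]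
  have e2 : ∀ c, ev (Lpt n ρ c) = s / (1 + s) * ev (Lt n ρ c) := fun c => by
    rw [Lpt_tot, ev_mul (limU c).bd (limL c).bd, evU]
  have evP : ∀ c, ev (Lpt n ρ c) = s := fun c => by
    have := e2 c
    rw [e1] at this
    field_simp at this
    linear_combination this
  exact ⟨l, hl, limU, evU, limN, limP, limL, fun c => by rw [e1, evP], evP⟩

section osc
variable {l : ℝ}

lemma Uf_nn (h : Par n s ρ) (f : BF n) (m : ℕ) : 0 ≤ coeff m (Uf n ρ c f) := gw_nonneg h.ρ_pos.le (fun _ => ind_nonneg _) m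
lemma Lf_nn (h : Par n s ρ) (f : BF n) (m : ℕ) : 0 ≤ coeff m (Lf n ρ c f) := gw_nonneg h.ρ_pos.le (fun _ => ind_nonneg _) m
lemma Lpf_nn (h : Par n s ρ) (f : BF n) (m : ℕ) : 0 ≤ coeff m (Lpf n ρ c f) := gw_nonneg h.ρ_pos.le (fun _ => ind_nonneg _) m
lemma Nf_nn (h : Par n s ρ) (f : BF n) (m : ℕ) : 0 ≤ coeff m (Nf n ρ c f) := gw_nonneg h.ρ_pos.le (fun _ => ind_nonneg _) m

lemma Uf_bd (h : Par n s ρ) (T : Tot n s ρ l) (f : BF n) : Bd (Uf n ρ c f) :=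
  (T.limU c).bd.of_le (Uf_nn h f) (gw_mono h.ρ_pos.le fun _ => ind_mono And.left)
lemma Lf_bd (h : Par n s ρ) (T : Tot n s ρ l) (f : BF n) : Bd (Lf n ρ c f) :=
  (T.limL c).bd.of_le (Lf_nn h f) (gw_mono h.ρ_pos.le fun _ => ind_mono And.left)
lemma Lpf_bd (h : Par n s ρ) (T : Tot n s ρ l) (f : BF n) : Bd (Lpf n ρ c f) :=
  (T.limP c).bd.of_le (Lpf_nn h f) (gw_mono h.ρ_pos.le fun _ => ind_mono And.left)
lemma Nf_bd (h : Par n s ρ) (T : Tot n s ρ l) (f : BF n) : Bd (Nf n ρ c f) :=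
  (T.limN c).bd.of_le (Nf_nn h f) (gw_mono h.ρ_pos.le fun _ => ind_mono And.left)

lemma Lpf_osc (h : Par n s ρ) (T : Tot n s ρ l) (f : BF n) : OscLe (Lpf n ρ c f) (∑ q ∈ fibre n c f,
    (ev (Uf n ρ c q.1) * osc (Lf n ρ c q.2) + ev (Lf n ρ c q.2) * osc (Uf n ρ c q.1))) := by
  rw [Lpf_eq]
  refine OscLe.sum fun q _ => ?_
  rw [← ea_eq_ev (Uf_nn h _), ← ea_eq_ev (Lf_nn h _)]
  exact OscLe.mul (Uf_bd h T _) (Lf_bd h T _) (osc_nonneg _) (osc_nonneg _) (Uf_bd h T _).oscLe (Lf_bd h T _).oscLe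

lemma ev_Ut_sum (h : Par n s ρ) (T : Tot n s ρ l) : ∑ f, ev (Uf n ρ c f) = s / (1 + s) := by
  rw [← T.evU c, Ut_eq, ev_sum fun f _ => Uf_bd h T f]
lemma ev_Lt_sum (h : Par n s ρ) (T : Tot n s ρ l) : ∑ f, ev (Lf n ρ c f) = 1 + s := by
  rw [← T.evL c, Lt_eq, ev_sum fun f _ => Lf_bd h T f]
lemma ev_Lpt_sum (h : Par n s ρ) (T : Tot n s ρ l) : ∑ f, ev (Lpf n ρ c f) = s := by
  rw [← T.evP c, Lpt_eq, ev_sum fun f _ => Lpf_bd h T f]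

lemma Lpf_osc_sum_aux (h : Par n s ρ) (T : Tot n s ρ l) : ∑ f, ∑ q ∈ fibre n c f,
    (ev (Uf n ρ c q.1) * osc (Lf n ρ c q.2) + ev (Lf n ρ c q.2) * osc (Uf n ρ c q.1))
    = s / (1 + s) * ∑ f, osc (Lf n ρ c f) + (1 + s) * ∑ f, osc (Uf n ρ c f) := by
  rw [sum_fibre (fun q : BF n × BF n =>
    (ev (Uf n ρ c q.1) * osc (Lf n ρ c q.2) + ev (Lf n ρ c q.2) * osc (Uf n ρ c q.1)))]
  rw [Finset.sum_add_distrib, ← ev_Ut_sum h T (c := c), ← ev_Lt_sum h T (c := c), Finset.sum_mul_sum, Finset.sum_mul_sum,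
    Fintype.sum_prod_type, Fintype.sum_prod_type]
  congr 1
  rw [Finset.sum_comm]

lemma ev_nn {F : ℝ⟦X⟧} (hF : ∀ m, 0 ≤ coeff m F) : 0 ≤ ev F := tsum_nonneg hF

lemma bnd_nn (h : Par n s ρ) (T : Tot n s ρ l) (f : BF n) : 0 ≤ ∑ q ∈ fibre n c f,
    (ev (Uf n ρ c q.1) * osc (Lf n ρ c q.2) + ev (Lf n ρ c q.2) * osc (Uf n ρ c q.1)) := 
  Finset.sum_nonneg fun _ _ => add_nonneg (mul_nonneg (ev_nn (Uf_nn h _)) (osc_nonneg _))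
    (mul_nonneg (ev_nn (Lf_nn h _)) (osc_nonneg _))

lemma XL_le (h : Par n s ρ) (T : Tot n s ρ l) : ∑ f, osc (Lf n ρ c f) ≤ (1 + s) ^ 2 * ∑ f, osc (Uf n ρ c f) := by
  have h1 : ∑ f, osc (Lf n ρ c f) ≤ s / (1 + s) * ∑ f, osc (Lf n ρ c f) + (1 + s) * ∑ f, osc (Uf n ρ c f) := by
    rw [← Lpf_osc_sum_aux h T]
    refine Finset.sum_le_sum fun f _ => osc_le (bnd_nn h T f) ?_
    rw [Lf_eq]
    simpa using (lim_C _).osc.add (Lpf_osc h T f)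
  have hs := h.hs
  set a := ∑ f, osc (Lf n ρ c f)
  set b := ∑ f, osc (Uf n ρ c f)
  have h2 : a = s / (1 + s) * a + a / (1 + s) := by field_simp; ring
  have h3 : a / (1 + s) ≤ (1 + s) * b := by linarith
  rw [div_le_iff₀ (by positivity)] at h3
  linarith

lemma YL_le (h : Par n s ρ) (T : Tot n s ρ l) : ∑ f, osc (Lpf n ρ c f) ≤ (1 + s) ^ 2 * ∑ f, osc (Uf n ρ c f) := by
  have h1 : ∑ f, osc (Lpf n ρ c f) ≤ s / (1 + s) * ∑ f, osc (Lf n ρ c f) + (1 + s) * ∑ f, osc (Uf n ρ c f) := by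
    rw [← Lpf_osc_sum_aux h T]
    exact Finset.sum_le_sum fun f _ => osc_le (bnd_nn h T f) (Lpf_osc h T f)
  have hs := h.hs
  have h2 := XL_le h T (c := c)
  refine h1.trans ?_
  have : s / (1 + s) * ∑ f, osc (Lf n ρ c f) ≤ s / (1 + s) * ((1 + s) ^ 2 * ∑ f, osc (Uf n ρ c f)) := by
    gcongr
  refine (add_le_add_left this _).trans (le_of_eq ?_)
  field_simp
  ring

/-- absorbing constant -/
def ab (n : ℕ) (c : Bool) : BF n := fun _ => !c

lemma star_ab (g : BF n) : star c g (ab n c) = ab n c := by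
  funext x; cases c <;> simp [star, ab]

open Classical in
/-- bound for a pair -/
noncomputable def bq (n : ℕ) (ρ : ℝ) (c : Bool) (q : BF n × BF n) : ℝ :=
  ev (Uf n ρ c q.1) * osc (Lpf n ρ c q.2)
    + if q.2 = ab n c then 0 else ev (Lpf n ρ c q.2) * osc (Uf n ρ c q.1)

lemma bq_nonneg (h : Par n s ρ) (T : Tot n s ρ l) (q : BF n × BF n) : 0 ≤ bq n ρ c q := by
  unfold bq
  refine add_nonneg (mul_nonneg (ev_nn (Uf_nn h _)) (osc_nonneg _)) ?_
  split_ifs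
  · exact le_rfl
  · exact (mul_nonneg (ev_nn (Lpf_nn h _)) (osc_nonneg _))

lemma N_osc (h : Par n s ρ) (T : Tot n s ρ l) (f : BF n) : OscLe (∑ q ∈ fibre n c f, Uf n ρ c q.1 * Lpf n ρ c q.2)
    (∑ q ∈ fibre n c f, bq n ρ c q) := by
  classical
  rw [← Finset.sum_filter_add_sum_filter_not _ (fun q : BF n × BF n => q.2 = ab n c),
    ← Finset.sum_filter_add_sum_filter_not (fibre n c f) (fun q : BF n × BF n => q.2 = ab n c) (bq n ρ c)]
  refine OscLe.add ?_ (OscLe.sum fun q hq => ?_)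
  · by_cases hf : f = ab n c
    · have : (fibre n c f).filter (fun q : BF n × BF n => q.2 = ab n c)
          = Finset.univ.image fun g : BF n => (g, ab n c) := by
        ext ⟨a, b⟩
        simp only [Finset.mem_filter, mem_fibre, Finset.mem_image, Finset.mem_univ, true_and, Prod.mk.injEq,
          exists_eq_left]
        constructor
        · rintro ⟨_, rfl⟩; rfl
        · rintro rfl; exact ⟨by rw [hf, star_ab], rfl⟩
      have inj : Function.Injective fun g : BF n => (g, ab n c) := fun a b hab => (Prod.mk.inj hab).1
      rw [this, Finset.sum_image (fun a _ b _ hab => inj hab), Finset.sum_image (fun a _ b _ hab => inj hab)]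
      simp only [bq, if_true, add_zero]
      rw [← Finset.sum_mul, ← Finset.sum_mul, ← Ut_eq, ev_Ut_sum h T, ← T.evU c]
      rw [← ea_eq_ev (F := Ut n ρ c) (gw_nonneg h.ρ_pos.le fun _ => ind_nonneg _)]
      simpa using OscLe.mul (T.limU c).bd (Lpf_bd h T (c := c) (ab n c)) le_rfl (osc_nonneg _) (T.limU c).osc
        (Lpf_bd h T _).oscLe
    · have : (fibre n c f).filter (fun q : BF n × BF n => q.2 = ab n c) = ∅ := by
        rw [Finset.filter_eq_empty_iff]
        intro q hq hq2
        rw [mem_fibre, hq2, star_ab] at hq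
        exact hf hq.symm
      rw [this]
      simpa using (lim_of_zero (F := 0) (N := 0) (by simp)).osc
  · have hq2 := (Finset.mem_filter.1 hq).2
    rw [bq, if_neg hq2, ← ea_eq_ev (Uf_nn h _), ← ea_eq_ev (Lpf_nn h _)]
    exact OscLe.mul (Uf_bd h T _) (Lpf_bd h T _) (osc_nonneg _) (osc_nonneg _) (Uf_bd h T _).oscLe (Lpf_bd h T _).oscLe

lemma bq_sum (h : Par n s ρ) (T : Tot n s ρ l) : ∑ f, ∑ q ∈ fibre n c f, bq n ρ c q
    = s / (1 + s) * ∑ f, osc (Lpf n ρ c f) + (s - ev (Lpf n ρ c (ab n c))) * ∑ f, osc (Uf n ρ c f) := by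
  classical
  rw [sum_fibre]
  unfold bq
  rw [Finset.sum_add_distrib, ← ev_Ut_sum h T (c := c), Finset.sum_mul_sum, Fintype.sum_prod_type]
  congr 1
  rw [Fintype.sum_prod_type, Finset.sum_comm, ← ev_Lpt_sum h T (c := c),
    ← Finset.add_sum_erase _ _ (Finset.mem_univ (ab n c)),
    ← Finset.add_sum_erase _ (fun f => ev (Lpf n ρ c f)) (Finset.mem_univ (ab n c)), add_sub_cancel_left, Finset.sum_mul_sum]
  simp only [if_true, Finset.sum_const_zero, zero_add]
  refine Finset.sum_congr rfl fun f hf => ?_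
  rw [Finset.mem_erase] at hf
  simp [hf.1]

lemma Nf_osc (h : Par n s ρ) (T : Tot n s ρ l) (f : BF n) : osc (Nf n ρ c f) ≤ ρ * ∑ q ∈ fibre n c f, bq n ρ c q := by
  have hρ := h.ρ_pos
  refine osc_le (mul_nonneg hρ.le (Finset.sum_nonneg fun q _ => bq_nonneg h T q)) ?_
  rw [Nf_eq, ← mul_assoc]
  have hb : Bd (∑ q ∈ fibre n c f, Uf n ρ c q.1 * Lpf n ρ c q.2) :=
    Bd.sum fun q _ => (Uf_bd h T _).mul (Lpf_bd h T _)
  have := OscLe.mul (lim_CX ρ).bd hb le_rfl (Finset.sum_nonneg fun q _ => bq_nonneg h T q) (lim_CX ρ).osc (N_osc h T f)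
  rw [ea_eq_ev, ev_CX] at this
  · simpa using this
  · intro m
    rw [coeff_C_mul, coeff_X]
    split_ifs <;> simp [hρ.le]

lemma XN_le (h : Par n s ρ) (T : Tot n s ρ l) : ∑ f, osc (Nf n ρ c f) ≤ (1 - ρ * ev (Lpf n ρ c (ab n c))) * ∑ f, osc (Uf n ρ c f) := by
  have hρ := h.ρ_pos
  have hs := h.hs
  have h1 : ∑ f, osc (Nf n ρ c f) ≤ ρ * ∑ f, ∑ q ∈ fibre n c f, bq n ρ c q := by
    rw [Finset.mul_sum]
    exact Finset.sum_le_sum fun f _ => Nf_osc h T f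
  rw [bq_sum h T] at h1
  have h2 := YL_le h T (c := c)
  refine h1.trans ?_
  have : s / (1 + s) * ∑ f, osc (Lpf n ρ c f) ≤ s / (1 + s) * ((1 + s) ^ 2 * ∑ f, osc (Uf n ρ c f)) := by
    gcongr
  have h3 := mul_le_mul_of_nonneg_left (add_le_add_left this ((s - ev (Lpf n ρ c (ab n c))) * ∑ f, osc (Uf n ρ c f))) hρ.le
  refine h3.trans (le_of_eq ?_)
  have h4 := h.ρ_eq
  have h5 : s / (1 + s) * ((1 + s) ^ 2 * ∑ f, osc (Uf n ρ c f)) = s * (1 + s) * ∑ f, osc (Uf n ρ c f) := by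
    field_simp
  rw [h5]
  linear_combination (∑ f, osc (Uf n ρ c f)) * h4

lemma XU_le (h : Par n s ρ) (T : Tot n s ρ l) : ∑ f, osc (Uf n ρ (!c) f) ≤ ∑ f, osc (Nf n ρ c f) := by
  refine Finset.sum_le_sum fun f _ => osc_le (osc_nonneg _) ?_
  rw [Uf_eq, Bool.not_not]
  simpa using (litf_lim f).osc.add (Nf_bd h T (c := c) f).oscLe

lemma ab_pos (h : Par n s ρ) (T : Tot n s ρ l) : 0 < ev (Lpf n ρ c (ab n c)) := by
  have hρ := h.ρ_pos
  have h1 : 0 < coeff 2 (Lpf n ρ c (ab n c)) := by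
    unfold Lpf
    rw [coeff_gw]
    refine mul_pos (by positivity) ?_
    let i : Fin n := ⟨0, h.hn⟩
    refine lt_of_lt_of_le ?_ (Finset.single_le_sum (fun y _ => ind_nonneg _)
      (mem_fib.2 (?_ : Sized.sz ([AT.leaf i true, AT.leaf i false] : List (AT n)) = 2)))
    · rw [ind_true]
      · norm_num
      · refine ⟨⟨?_, by simp⟩, ?_⟩
        · intro t ht
          simp only [List.mem_cons, List.not_mem_nil, or_false] at ht
          rcases ht with rfl | rfl <;> exact ⟨WF.leaf _ _, by simp [rootConn]⟩
        · funext x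
          cases c <;> simp [evalList, eval, ab]
    · rw [sz_list]; simp [sizeList, size]
  exact lt_of_lt_of_le h1 ((Lpf_bd h T _).summable'.le_tsum 2 fun m _ => Lpf_nn h _ m)

lemma XU_zero (h : Par n s ρ) (T : Tot n s ρ l) : ∑ f, osc (Uf n ρ c f) = 0 := by
  have hρ := h.ρ_pos
  have h1 := (XU_le h T (c := c)).trans (XN_le h T (c := c))
  have h2 := (XU_le h T (c := !c)).trans (XN_le h T (c := !c))
  rw [Bool.not_not] at h2
  have p1 := mul_pos hρ (ab_pos h T (c := c))
  have p2 := mul_pos hρ (ab_pos h T (c := !c))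
  have n1 : 0 ≤ ∑ f, osc (Uf n ρ c f) := Finset.sum_nonneg fun _ _ => osc_nonneg _
  have n2 : 0 ≤ ∑ f, osc (Uf n ρ (!c) f) := Finset.sum_nonneg fun _ _ => osc_nonneg _
  refine le_antisymm ?_ n1
  by_contra hlt
  push Not at hlt
  nlinarith [mul_pos p1 hlt, mul_nonneg p2.le n2]

theorem Nf_lim (h : Par n s ρ) (T : Tot n s ρ l) (f : BF n) : ∃ a, Lim (Nf n ρ c f) a := by
  have h1 := XN_le h T (c := c)
  rw [XU_zero h T, mul_zero] at h1
  have h2 : osc (Nf n ρ c f) = 0 := by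
    refine le_antisymm (le_trans ?_ h1) (osc_nonneg _)
    exact Finset.single_le_sum (f := fun f => osc (Nf n ρ c f)) (fun _ _ => osc_nonneg _) (Finset.mem_univ f)
  have h3 := (Nf_bd h T (c := c) f).oscLe
  rw [h2] at h3
  exact h3.lim

theorem Uf_lim (h : Par n s ρ) (T : Tot n s ρ l) (f : BF n) : ∃ a, Lim (Uf n ρ c f) a := by
  obtain ⟨a, ha⟩ := Nf_lim h T (c := !c) f
  exact ⟨_, by rw [Uf_eq]; exact (litf_lim f).add ha⟩

end osc

end Sub



open AT

namespace Sub
open Filter Topology PowerSeries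

variable {n : ℕ} {ρ s l : ℝ}

lemma Lim.sum {ι : Type*} {Q : Finset ι} {F : ι → ℝ⟦X⟧} {a : ι → ℝ} (h : ∀ i ∈ Q, Lim (F i) (a i)) :
    Lim (∑ i ∈ Q, F i) (∑ i ∈ Q, a i) := by
  classical
  induction Q using Finset.induction_on with
  | empty => simpa using lim_of_zero (F := 0) (N := 0) (by simp)
  | insert i Q hi ih =>
    rw [Finset.sum_insert hi, Finset.sum_insert hi]
    exact (h i (by simp)).add (ih fun j hj => h j (by simp [hj]))

lemma Lim.le {F G : ℝ⟦X⟧} {a b : ℝ} (hF : Lim F a) (hG : Lim G b) (h : ∀ m, coeff m F ≤ coeff m G) : a ≤ b := by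
  refine le_of_tendsto_of_tendsto' hF hG fun m => ?_
  unfold nv
  exact div_le_div_of_nonneg_right (h m) (cc_pos m).le

/-- families of trees indexed by a list of arbitrary children -/
lemma fam {ι : Type*} (hρ : 0 ≤ ρ) {S : AT n → Prop} {R : List (AT n) → Prop} (Q : Finset ι)
    (e : ι → List (AT n) → AT n) (d : ι → ℕ)
    (hd : ∀ q ∈ Q, ∀ r, size (e q r) = sizeList r + d q)
    (hinj : ∀ q ∈ Q, ∀ q' ∈ Q, ∀ r r', e q r = e q' r' → q = q' ∧ r = r')
    (hS : ∀ q ∈ Q, ∀ r, R r → S (e q r)) {a b : ℝ}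
    (ha : Lim (gw ρ fun t => ind (S t)) a) (hb : Lim (gw ρ fun r => ind (R r)) b) :
    (∑ q ∈ Q, ρ ^ d q) * b ≤ a := by
  classical
  have h1 : ∀ q ∈ Q, gw ρ (fun t : AT n => ind (∃ r, R r ∧ e q r = t))
      = C (ρ ^ d q) * (X ^ d q * gw ρ fun r => ind (R r)) := by
    intro q hq
    rw [gw_inj ρ (e q) (fun r r' h => (hinj q hq q hq r r' h).2) (d q)
      (fun r => by rw [sz_AT, sz_list, hd q hq])]
    · congr 4
      funext r
      congr 1
      apply propext
      constructor
      · rintro ⟨r', h', hrr⟩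
        rwa [← (hinj q hq q hq r' r hrr).2]
      · intro h; exact ⟨r, h, rfl⟩
    · intro t ht
      by_contra hcon
      refine ht (ind_false ?_)
      rintro ⟨r, _, h⟩
      exact hcon ⟨r, h⟩
  have h2 : Lim (gw ρ fun t : AT n => ∑ q ∈ Q, ind (∃ r, R r ∧ e q r = t)) (∑ q ∈ Q, ρ ^ d q * b) := by
    rw [gw_sum]
    refine Lim.sum fun q hq => ?_
    rw [h1 q hq]
    exact hb.shift _ _
  rw [Finset.sum_mul]
  refine h2.le ha (gw_mono hρ fun t => ?_)
  by_cases hex : ∃ q ∈ Q, ∃ r, R r ∧ e q r = t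
  · obtain ⟨q, hq, r, hr, rfl⟩ := hex
    rw [ind_true (hS q hq r hr), Finset.sum_eq_single_of_mem q hq]
    · rw [ind_true ⟨r, hr, rfl⟩]
    · intro q' hq' hne
      refine ind_false ?_
      rintro ⟨r', _, h'⟩
      exact hne (hinj q' hq' q hq r' r h').1
  · rw [Finset.sum_eq_zero]
    · exact ind_nonneg _
    · intro q hq
      refine ind_false fun h => hex ⟨q, hq, h⟩

/-- literals -/
abbrev Lit (n : ℕ) := Fin n × Bool
/-- leaf -/
def lf (p : Lit n) : AT n := AT.leaf p.1 p.2
/-- negation -/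
def ng (p : Lit n) : Lit n := (p.1, !p.2)
/-- value of a literal -/
def lv (p : Lit n) (x : Fin n → Bool) : Bool := if p.2 then x p.1 else !x p.1

lemma eval_lf (p : Lit n) (x : Fin n → Bool) : eval (lf p) x = lv p x := by
  simp [lf, eval, lv]
lemma lv_ng (p : Lit n) (x : Fin n → Bool) : lv (ng p) x = !lv p x := by
  rcases p with ⟨i, b⟩
  cases b <;> simp [lv, ng]
lemma lf_inj : Function.Injective (lf (n := n)) := by
  intro p q h
  simp only [lf, AT.leaf.injEq] at h
  exact Prod.ext h.1 h.2
lemma inU_lf (c : Bool) (p : Lit n) : inU c (lf p) := ⟨WF.leaf _ _, by simp [lf, rootConn]⟩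

lemma inL_append {c : Bool} {a b : List (AT n)} : inL c (a ++ b) ↔ inL c a ∧ inL c b := by
  simp only [inL, List.mem_append, or_imp, forall_and]
lemma inL_lf (c : Bool) (w : List (Lit n)) : inL c (w.map lf) := by
  intro t ht
  obtain ⟨p, _, rfl⟩ := List.mem_map.1 ht
  exact inU_lf c p

lemma sizeList_append (a b : List (AT n)) : sizeList (a ++ b) = sizeList a + sizeList b := by
  induction a with
  | nil => simp [sizeList]
  | cons t a ih => simp [sizeList, ih]; omega
lemma sizeList_lf (w : List (Lit n)) : sizeList (w.map lf) = w.length := by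
  induction w with
  | nil => simp [sizeList]
  | cons t a ih => simp [sizeList, ih, lf, size]; omega

lemma eval_or (ts : List (AT n)) (x : Fin n → Bool) :
    evalList false ts x = true ↔ ∃ t ∈ ts, eval t x = true := by
  induction ts with
  | nil => simp [evalList]
  | cons t ts ih => simp [evalList, ih]

/-- words avoiding a relation -/
def Wd (σ : Lit n → Lit n) : ℕ → Finset (List (Lit n))
  | 0 => {[]}
  | k + 1 => ((Wd σ k).sigma fun v => Finset.univ \ (v.map σ).toFinset).image fun q => q.2 :: q.1

lemma mem_Wd {σ : Lit n → Lit n} {k : ℕ} {w : List (Lit n)} (h : w ∈ Wd σ k) :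
    w.length = k ∧ w.Pairwise (fun p q => p ≠ σ q) := by
  induction k generalizing w with
  | zero => simp [Wd] at h; subst h; simp
  | succ k ih =>
    simp only [Wd, Finset.mem_image, Finset.mem_sigma, Finset.mem_sdiff, Finset.mem_univ, true_and,
      List.mem_toFinset] at h
    obtain ⟨⟨v, p⟩, ⟨hv, hp⟩, rfl⟩ := h
    obtain ⟨h1, h2⟩ := ih hv
    refine ⟨by simp [h1], List.pairwise_cons.2 ⟨?_, h2⟩⟩
    intro q hq hpq
    exact hp (List.mem_map.2 ⟨q, hq, hpq.symm⟩)

lemma card_Wd_succ (σ : Lit n → Lit n) (k : ℕ) :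
    (Wd σ (k + 1)).card = ∑ v ∈ Wd σ k, (Finset.univ \ (v.map σ).toFinset).card := by
  rw [Wd, Finset.card_image_of_injective, Finset.card_sigma]
  rintro ⟨v, p⟩ ⟨v', p'⟩ h
  simp only [List.cons.injEq] at h
  obtain ⟨rfl, rfl⟩ := h
  rfl

lemma card_Wd_le (σ : Lit n → Lit n) (k : ℕ) : ((Wd σ k).card : ℝ) ≤ (2 * n) ^ k := by
  induction k with
  | zero => simp [Wd]
  | succ k ih =>
    rw [card_Wd_succ]
    push_cast
    calc _ ≤ ∑ v ∈ Wd σ k, (2 * n : ℝ) := by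
          refine Finset.sum_le_sum fun v _ => ?_
          have := Finset.card_le_univ (Finset.univ \ (v.map σ).toFinset)
          simp only [Fintype.card_prod, Fintype.card_fin, Fintype.card_bool] at this
          have h2 : (((Finset.univ \ (v.map σ).toFinset).card : ℕ) : ℝ) ≤ ((n * 2 : ℕ) : ℝ) := by exact_mod_cast this
          push_cast at h2
          linarith
      _ ≤ _ := by
          rw [Finset.sum_const, nsmul_eq_mul, pow_succ]
          gcongr

lemma card_Wd_ge (hn : 1 ≤ n) (σ : Lit n → Lit n) (k : ℕ) :
    (2 * n : ℝ) ^ k * (1 - k * (k - 1) / (4 * n)) ≤ (Wd σ k).card := by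
  have hn' : (0 : ℝ) < n := by exact_mod_cast hn
  induction k with
  | zero => simp [Wd]
  | succ k ih =>
    rw [card_Wd_succ]
    push_cast
    have h1 : ∑ v ∈ Wd σ k, (2 * n - k : ℝ) ≤ ∑ v ∈ Wd σ k, ((Finset.univ \ (v.map σ).toFinset).card : ℝ) := by
      refine Finset.sum_le_sum fun v hv => ?_
      have h2 := Finset.le_card_sdiff (v.map σ).toFinset Finset.univ
      have h3 := List.toFinset_card_le (v.map σ)
      rw [List.length_map, (mem_Wd hv).1] at h3
      have h4 : (Finset.univ : Finset (Lit n)).card = n * 2 := by simp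
      rw [h4] at h2
      have h5 : n * 2 ≤ (Finset.univ \ (v.map σ).toFinset).card + k := by omega
      have h6 : ((n * 2 : ℕ) : ℝ) ≤ (((Finset.univ \ (v.map σ).toFinset).card + k : ℕ) : ℝ) := by exact_mod_cast h5
      push_cast at h6
      linarith
    refine le_trans ?_ h1
    rw [Finset.sum_const, nsmul_eq_mul]
    have h7 := card_Wd_le σ k
    have h8 := mul_le_mul_of_nonneg_right ih (by positivity : (0 : ℝ) ≤ 2 * n)
    have h9 := mul_le_mul_of_nonneg_right h7 (by positivity : (0 : ℝ) ≤ k)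
    have : (2 * n : ℝ) ^ (k + 1) * (1 - (k + 1) * (k + 1 - 1) / (4 * n))
        = (2 * n : ℝ) ^ k * (1 - k * (k - 1) / (4 * n)) * (2 * n) - (2 * n) ^ k * k := by
      field_simp
      ring
    rw [this]
    linarith

lemma card_Wd_half (hn : 1 ≤ n) (σ : Lit n → Lit n) (k : ℕ) (hk : k * (k - 1) ≤ 2 * n) :
    (2 * n : ℝ) ^ k / 2 ≤ (Wd σ k).card := by
  have hn' : (0 : ℝ) < n := by exact_mod_cast hn
  refine le_trans ?_ (card_Wd_ge hn σ k)
  have h1 : (k : ℝ) * (k - 1) ≤ 2 * n := by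
    rcases k with _ | k
    · simp
    · have : (((k + 1) * (k + 1 - 1) : ℕ) : ℝ) ≤ ((2 * n : ℕ) : ℝ) := by exact_mod_cast hk
      push_cast at this ⊢
      simpa using this
  have h2 : (k : ℝ) * (k - 1) / (4 * n) ≤ 1 / 2 := by
    rw [div_le_iff₀ (by positivity)]; linarith
  have h3 : (0 : ℝ) ≤ (2 * n) ^ k := by positivity
  nlinarith

lemma exp_bound (h : Par n s ρ) (k : ℕ) {A : ℝ} (hk : 2 * (k : ℝ) ≤ A * s) :
    Real.exp (-A) ≤ (2 * n * ρ) ^ k := by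
  have hs := h.hs
  have h1 : 2 * n * ρ = s / (s + 2) := by
    rw [← h.hs2, h.hρ]; field_simp
  have h2 : Real.exp (-(2 / s)) ≤ 2 * n * ρ := by
    rw [h1, Real.exp_neg, inv_le_comm₀ (Real.exp_pos _) (by positivity), inv_div]
    have := Real.add_one_le_exp (2 / s)
    refine le_trans (le_of_eq ?_) this
    field_simp
    ring
  calc Real.exp (-A) ≤ Real.exp (k * (-(2 / s))) := by
        rw [Real.exp_le_exp]
        have : (k : ℝ) * (2 / s) ≤ A := by
          rw [← mul_div_assoc, div_le_iff₀ hs]; linarith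
        linarith
    _ = Real.exp (-(2 / s)) ^ k := Real.exp_nat_mul _ _
    _ ≤ _ := by gcongr

lemma exists_K (hn : 1 ≤ n) : ∃ K, 1 ≤ K ∧ K * (K + 1) ≤ 2 * n ∧ 2 * n < (K + 1) * (K + 2) := by
  have hex : ∃ K, 2 * n < (K + 1) * (K + 2) := ⟨2 * n, by nlinarith⟩
  classical
  refine ⟨Nat.find hex, ?_, ?_, Nat.find_spec hex⟩
  · rw [Nat.one_le_iff_ne_zero]
    intro h0
    have := Nat.find_spec hex
    rw [h0] at this
    omega
  · by_contra hcon
    push Not at hcon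
    have h1 : Nat.find hex ≠ 0 := by
      intro h0
      rw [h0] at hcon; omega
    obtain ⟨j, hj⟩ := Nat.exists_eq_succ_of_ne_zero h1
    have := Nat.find_min hex (m := j) (by omega)
    apply this
    rw [hj] at hcon
    exact hcon

lemma Par.one_le_s (h : Par n s ρ) : 1 ≤ s := by
  have := h.two_le
  have := h.hs
  nlinarith

lemma K_le (h : Par n s ρ) {K : ℕ} (hK : K * (K + 1) ≤ 2 * n) : (K : ℝ) ≤ s := by
  have h1 : ((K * (K + 1) : ℕ) : ℝ) ≤ ((2 * n : ℕ) : ℝ) := by exact_mod_cast hK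
  push_cast at h1
  rw [← h.hs2] at h1
  have := h.hs
  have h0 : (0 : ℝ) ≤ K := by positivity
  nlinarith

lemma ρ_mul (h : Par n s ρ) : 1 ≤ ρ * (1 + s) ^ 2 := by
  have := h.ρ_eq
  have := h.ρ_pos
  nlinarith

/-- the words hitting the complement -/
noncomputable def Hit (n h : ℕ) (a : List (Lit n)) : Finset (Fin h → Lit n) :=
  Finset.univ \ Fintype.piFinset fun _ => Finset.univ \ (a.map ng).toFinset

lemma ng_inj : Function.Injective (ng (n := n)) := by
  rintro ⟨i, b⟩ ⟨j, d⟩ h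
  simpa [ng] using h

lemma mem_Hit {h : ℕ} {a : List (Lit n)} {b : Fin h → Lit n} (hb : b ∈ Hit n h a) :
    ∃ p ∈ a, ∃ j, b j = ng p := by
  simp only [Hit, Finset.mem_sdiff, Finset.mem_univ, true_and, Fintype.mem_piFinset, List.mem_toFinset,
    List.mem_map, not_forall, not_not] at hb
  obtain ⟨j, p, hp, hj⟩ := hb
  exact ⟨p, hp, j, hj.symm⟩

lemma card_Hit {h : ℕ} (h1 : 1 ≤ n) (h2 : h ≤ 2 * n) (h3 : n ≤ h ^ 2) {a : List (Lit n)}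
    (ha : a ∈ Wd id h) : (2 * n : ℝ) ^ h / 3 ≤ (Hit n h a).card := by
  obtain ⟨hl, hp⟩ := mem_Wd ha
  have hnd : (a.map ng).toFinset.card = h := by
    rw [List.toFinset_card_of_nodup, List.length_map, hl]
    exact List.Nodup.map ng_inj hp
  have hc : (Hit n h a).card = (2 * n) ^ h - (2 * n - h) ^ h := by
    rw [Hit, Finset.card_sdiff_of_subset (Finset.subset_univ _), Fintype.card_piFinset]
    simp only [Finset.card_sdiff_of_subset (Finset.subset_univ _), hnd, Finset.prod_const, Finset.card_univ,
      Fintype.card_prod, Fintype.card_fin, Fintype.card_bool, Fintype.card_pi]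
    rw [mul_comm n 2]
  have hle : (2 * n - h) ^ h ≤ (2 * n) ^ h := Nat.pow_le_pow_left (Nat.sub_le _ _) _
  rw [hc, Nat.cast_sub hle]
  push_cast [Nat.cast_sub h2]
  have hn' : (0 : ℝ) < n := by exact_mod_cast h1
  have h2' : (h : ℝ) ≤ 2 * n := by exact_mod_cast h2
  have h3' : (n : ℝ) ≤ h ^ 2 := by exact_mod_cast h3
  set x : ℝ := h / (2 * n) with hx
  have hx0 : 0 ≤ x := by positivity
  have hx1 : x ≤ 1 := by rw [hx, div_le_one (by positivity)]; exact h2'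
  have e1 : (2 * n - h : ℝ) = (2 * n) * (1 - x) := by rw [hx]; field_simp
  have e2 : (2 * n - h : ℝ) ^ h = (2 * n) ^ h * (1 - x) ^ h := by rw [e1, mul_pow (2 * n : ℝ)]
  rw [e2]
  have b1 : (1 - x) ^ h * (1 + x) ^ h ≤ 1 := by
    rw [← mul_pow]
    exact pow_le_one₀ (by nlinarith) (by nlinarith)
  have b2 : 1 + h * x ≤ (1 + x) ^ h := one_add_mul_le_pow (by linarith) h
  have b3 : (1 : ℝ) / 2 ≤ h * x := by
    rw [hx, ← mul_div_assoc, le_div_iff₀ (by positivity)]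
    nlinarith
  have b4 : 0 ≤ (1 - x) ^ h := pow_nonneg (by linarith) _
  have b5 : (1 - x) ^ h ≤ 2 / 3 := by nlinarith
  have b6 : (0 : ℝ) ≤ (2 * n) ^ h := by positivity
  nlinarith

theorem lower (h : Par n s ρ) (T : Tot n s ρ l) {a : ℝ}
    (ha : Lim (gw ρ fun t : AT n => ind (WF t ∧ eval t = fun _ => true)) a) :
    l * (Real.exp (-8) / 6) ≤ a := by
  classical
  obtain ⟨K, hK1, hK2, hK3⟩ := exists_K h.hn
  have hρ := h.ρ_pos
  have hl := T.l_pos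
  have key := fam (n := n) hρ.le (S := fun t => WF t ∧ eval t = fun _ => true) (R := inL false)
    ((Wd id (K + 1)).sigma fun w => Hit n (K + 1) w)
    (fun q r => AT.node false (q.1.map lf ++ ((List.ofFn q.2).map lf ++ r)))
    (fun _ => 1 + 2 * (K + 1)) ?_ ?_ ?_ ha (T.limL false)
  · refine le_trans ?_ key
    rw [Finset.sum_sigma]
    have h1 : ∀ w ∈ Wd (n := n) id (K + 1), (2 * n : ℝ) ^ (K + 1) / 3 * ρ ^ (1 + 2 * (K + 1))
        ≤ ∑ b ∈ Hit n (K + 1) w, ρ ^ (1 + 2 * (K + 1)) := by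
      intro w hw
      rw [Finset.sum_const, nsmul_eq_mul]
      gcongr
      refine card_Hit h.hn ?_ ?_ hw <;> nlinarith
    have h2 := Finset.sum_le_sum h1
    rw [Finset.sum_const, nsmul_eq_mul] at h2
    have h3 := card_Wd_half h.hn (id : Lit n → Lit n) (K + 1) (by rw [Nat.add_sub_cancel, mul_comm]; exact hK2)
    have h4 : (2 * n : ℝ) ^ (K + 1) / 2 * ((2 * n : ℝ) ^ (K + 1) / 3 * ρ ^ (1 + 2 * (K + 1)))
        ≤ ((Wd (n := n) id (K + 1)).card : ℝ) * ((2 * n : ℝ) ^ (K + 1) / 3 * ρ ^ (1 + 2 * (K + 1))) := by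
      gcongr
    have h5 := h4.trans h2
    have h6 : (2 * n : ℝ) ^ (K + 1) / 2 * ((2 * n : ℝ) ^ (K + 1) / 3 * ρ ^ (1 + 2 * (K + 1)))
        = (2 * n * ρ) ^ (2 * (K + 1)) / 6 * ρ := by
      rw [mul_pow, pow_add ρ, two_mul (K + 1), pow_add, pow_add]; ring
    rw [h6] at h5
    have h7 : Real.exp (-8) ≤ (2 * n * ρ) ^ (2 * (K + 1)) := by
      refine exp_bound h _ ?_
      have := K_le h hK2
      have := h.one_le_s
      push_cast
      linarith
    have h8 := ρ_mul h
    calc l * (Real.exp (-8) / 6) ≤ l * (Real.exp (-8) / 6) * (ρ * (1 + s) ^ 2) :=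
          le_mul_of_one_le_right (by positivity) h8
      _ = (Real.exp (-8) / 6 * ρ) * (l * (1 + s) ^ 2) := by ring
      _ ≤ ((2 * n * ρ) ^ (2 * (K + 1)) / 6 * ρ) * (l * (1 + s) ^ 2) := by gcongr
      _ ≤ _ := by gcongr
  · rintro ⟨w, b⟩ hq r
    rw [Finset.mem_sigma] at hq
    simp only [size, sizeList_append, sizeList_lf, (mem_Wd hq.1).1, List.length_ofFn]
    omega
  · rintro ⟨w, b⟩ hq ⟨w', b'⟩ hq' r r' heq
    rw [Finset.mem_sigma] at hq hq'
    simp only [AT.node.injEq, true_and] at heq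
    obtain ⟨e1, e2⟩ := List.append_inj heq (by simp [(mem_Wd hq.1).1, (mem_Wd hq'.1).1])
    obtain ⟨e3, e4⟩ := List.append_inj e2 (by simp)
    have e5 : w = w' := lf_inj.list_map e1
    have e6 : b = b' := List.ofFn_injective (lf_inj.list_map e3)
    subst e5 e6
    exact ⟨rfl, e4⟩
  · rintro ⟨w, b⟩ hq r hr
    rw [Finset.mem_sigma] at hq
    refine ⟨wf_node.2 ⟨?_, ?_⟩, ?_⟩
    · simp [(mem_Wd hq.1).1]; omega
    · exact inL_append.2 ⟨inL_lf _ _, inL_append.2 ⟨inL_lf _ _, hr⟩⟩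
    · funext x
      obtain ⟨p, hp, j, hj⟩ := mem_Hit hq.2
      rw [eval, eval_or]
      by_cases hx : lv p x = true
      · exact ⟨lf p, List.mem_append_left _ (List.mem_map.2 ⟨p, hp, rfl⟩), by rw [eval_lf, hx]⟩
      · refine ⟨lf (ng p), ?_, by rw [eval_lf, lv_ng]; simpa using hx⟩
        rw [List.mem_append, List.mem_append]
        right; left
        refine List.mem_map.2 ⟨_, ?_, rfl⟩
        rw [List.mem_ofFn]
        exact ⟨j, hj⟩

end Sub



open AT

namespace Sub
open Filter Topology PowerSeries

variable {n : ℕ} {ρ s l : ℝ}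

lemma lf_split {a a' b b' : List (Lit n)} {u u' : List (AT n)}
    (h : a.map lf ++ (AT.node true u :: b.map lf) = a'.map lf ++ (AT.node true u' :: b'.map lf)) :
    a = a' ∧ u = u' ∧ b = b' := by
  induction a generalizing a' with
  | nil =>
    cases a' with
    | nil =>
      simp only [List.map_nil, List.nil_append, List.cons.injEq, AT.node.injEq, true_and] at h
      exact ⟨rfl, h.1, lf_inj.list_map h.2⟩
    | cons p a' => simp [lf] at h
  | cons p a ih =>
    cases a' with
    | nil => simp [lf] at h
    | cons p' a' =>
      simp only [List.map_cons, List.cons_append, List.cons.injEq] at h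
      obtain ⟨h1, h2, h3⟩ := ih h.2
      exact ⟨by rw [lf_inj h.1, h1], h2, h3⟩

/-- the tree of the second family -/
def tr (i : ℕ) (w : List (Lit n)) (r : List (AT n)) : AT n :=
  AT.node false ((w.tail.take i).map lf ++
    (AT.node true ((w.take 1).map lf ++ r) :: (w.tail.drop i).map lf))

lemma falsify {w : List (Lit n)} (hw : w.Pairwise fun p q => p ≠ ng q) :
    ∃ x : Fin n → Bool, ∀ p ∈ w, lv p x = false := by
  classical
  refine ⟨fun i => decide ((i, false) ∈ w), ?_⟩
  rintro ⟨i, b⟩ hp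
  cases b with
  | false => simpa [lv] using hp
  | true =>
    simp only [lv, if_true, decide_eq_false_iff_not]
    intro hp'
    have hsymm : Std.Symm (fun p q : Lit n => p ≠ ng q) := ⟨by
      rintro ⟨i, b⟩ ⟨j, d⟩ h1 h2
      apply h1
      simp only [ng, Prod.mk.injEq] at h2 ⊢
      obtain ⟨rfl, rfl⟩ := h2
      simp⟩
    exact List.Pairwise.forall hw hp hp' (by simp) (by simp [ng])

theorem upper (h : Par n s ρ) (T : Tot n s ρ l) {a : ℝ}
    (ha : Lim (gw ρ fun t : AT n => ind (WF t ∧ eval t ≠ (fun _ => true) ∧ eval t ≠ fun _ => false)) a) :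
    l * (Real.exp (-4) / 18) ≤ a := by
  classical
  obtain ⟨K, hK1, hK2, hK3⟩ := exists_K h.hn
  have hρ := h.ρ_pos
  have hl := T.l_pos
  have key := fam (n := n) hρ.le (S := fun t => WF t ∧ eval t ≠ (fun _ => true) ∧ eval t ≠ fun _ => false)
    (R := fun r => inL true r ∧ r ≠ [])
    ((Finset.Icc 1 K).sigma fun k => Finset.range (k + 1) ×ˢ Wd ng (k + 1))
    (fun q r => tr q.2.1 q.2.2 r)
    (fun q => q.1 + 3) ?_ ?_ ?_ ha (T.limP true)
  · refine le_trans ?_ key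
    rw [Finset.sum_sigma]
    have h1 : ∀ k ∈ Finset.Icc 1 K, ((k : ℝ) + 1) * (Real.exp (-4) / 2 * ρ ^ 2)
        ≤ ∑ q ∈ Finset.range (k + 1) ×ˢ Wd (n := n) ng (k + 1), ρ ^ (k + 3) := by
      intro k hk
      rw [Finset.mem_Icc] at hk
      have hk2 : k * (k + 1) ≤ 2 * n := le_trans (Nat.mul_le_mul hk.2 (by omega)) hK2
      rw [Finset.sum_const, nsmul_eq_mul, Finset.card_product, Finset.card_range]
      push_cast
      have h3 := card_Wd_half h.hn (ng : Lit n → Lit n) (k + 1) (by rw [Nat.add_sub_cancel, mul_comm]; exact hk2)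
      have h7 : Real.exp (-4) ≤ (2 * n * ρ) ^ (k + 1) := by
        refine exp_bound h _ ?_
        have := K_le h hk2
        have := h.one_le_s
        push_cast
        linarith
      calc ((k : ℝ) + 1) * (Real.exp (-4) / 2 * ρ ^ 2) ≤ ((k : ℝ) + 1) * ((2 * n * ρ) ^ (k + 1) / 2 * ρ ^ 2) := by gcongr
        _ = ((k : ℝ) + 1) * ((2 * n) ^ (k + 1) / 2) * ρ ^ (k + 3) := by rw [mul_pow]; ring
        _ ≤ _ := by gcongr
    have h2 := Finset.sum_le_sum h1
    rw [← Finset.sum_mul] at h2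
    have hsum : ∀ K : ℕ, ∑ k ∈ Finset.Icc 1 K, ((k : ℝ) + 1) = K * (K + 3) / 2 := by
      intro K
      induction K with
      | zero => simp
      | succ K ih =>
        rw [Finset.sum_Icc_succ_top (by omega), ih]
        push_cast; ring
    rw [hsum] at h2
    have hK : s ^ 2 / 3 ≤ (K : ℝ) * (K + 3) / 2 := by
      have a1 : ((2 * n : ℕ) : ℝ) < (((K + 1) * (K + 2) : ℕ) : ℝ) := by exact_mod_cast hK3
      have a2 : (1 : ℝ) ≤ K := by exact_mod_cast hK1
      push_cast at a1
      rw [h.hs2]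
      nlinarith
    have h8 := ρ_mul h
    have h9 : 1 / 3 ≤ ρ * s ^ 2 := by
      have := h.ρ_eq
      have := h.one_le_s
      nlinarith [mul_nonneg hρ.le (mul_nonneg h.hs.le (sub_nonneg.2 h.one_le_s))]
    calc l * (Real.exp (-4) / 18) = l * (Real.exp (-4) / 6) * (1 / 3) * 1 := by ring
      _ ≤ l * (Real.exp (-4) / 6) * (ρ * s ^ 2) * (ρ * (1 + s) ^ 2) := by gcongr
      _ = (s ^ 2 / 3 * (Real.exp (-4) / 2 * ρ ^ 2)) * (l * (1 + s) ^ 2) := by ring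
      _ ≤ (K * (K + 3) / 2 * (Real.exp (-4) / 2 * ρ ^ 2)) * (l * (1 + s) ^ 2) := by gcongr
      _ ≤ _ := by gcongr
  · rintro ⟨k, i, w⟩ hq r
    simp only [Finset.mem_sigma, Finset.mem_product, Finset.mem_range] at hq
    have hw := (mem_Wd hq.2.2).1
    simp only [tr, size, sizeList_append, sizeList_lf, sizeList, List.length_take, List.length_drop, List.length_tail, hw]
    omega
  · rintro ⟨k, i, w⟩ hq ⟨k', i', w'⟩ hq' r r' heq
    simp only [Finset.mem_sigma, Finset.mem_product, Finset.mem_range] at hq hq'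
    have hw := (mem_Wd hq.2.2).1
    have hw' := (mem_Wd hq'.2.2).1
    simp only [tr, AT.node.injEq, true_and] at heq
    obtain ⟨e1, e2, e3⟩ := lf_split heq
    obtain ⟨e4, e5⟩ := List.append_inj e2 (by simp [hw, hw'])
    have e6 := lf_inj.list_map e4
    have e7 : w.tail = w'.tail := by
      rw [← List.take_append_drop i w.tail, e1, e3, List.take_append_drop]
    have e8 : w = w' := by
      rw [← List.take_append_drop 1 w, ← List.take_append_drop 1 w', e6, List.drop_one, List.drop_one, e7]
    subst e8
    have e9 : k = k' := by omega
    subst e9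
    have e10 : i = i' := by
      have := congrArg List.length e1
      simp only [List.length_take, List.length_tail, hw] at this
      omega
    subst e10
    exact ⟨rfl, e5⟩
  · rintro ⟨k, i, w⟩ hq r ⟨hr, hr0⟩
    simp only [Finset.mem_sigma, Finset.mem_product, Finset.mem_range, Finset.mem_Icc] at hq
    obtain ⟨hw, hpw⟩ := mem_Wd hq.2.2
    have hkey : ∀ x, eval (tr i w r) x = true ↔
        (∃ p ∈ w.tail, lv p x = true) ∨ eval (AT.node true ((w.take 1).map lf ++ r)) x = true := by
      intro x
      rw [tr, eval, eval_or]
      constructor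
      · rintro ⟨t, ht, htx⟩
        rw [List.mem_append, List.mem_cons] at ht
        rcases ht with ht | rfl | ht
        · obtain ⟨p, hp, rfl⟩ := List.mem_map.1 ht
          rw [eval_lf] at htx
          exact Or.inl ⟨p, List.mem_of_mem_take hp, htx⟩
        · exact Or.inr htx
        · obtain ⟨p, hp, rfl⟩ := List.mem_map.1 ht
          rw [eval_lf] at htx
          exact Or.inl ⟨p, List.mem_of_mem_drop hp, htx⟩
      · rintro (⟨p, hp, hpx⟩ | hx)
        · refine ⟨lf p, ?_, by rw [eval_lf, hpx]⟩
          rw [← List.take_append_drop i w.tail, List.mem_append] at hp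
          rw [List.mem_append, List.mem_cons]
          rcases hp with hp | hp
          · exact Or.inl (List.mem_map.2 ⟨p, hp, rfl⟩)
          · exact Or.inr (Or.inr (List.mem_map.2 ⟨p, hp, rfl⟩))
        · exact ⟨_, by simp, hx⟩
    cases w with
    | nil => simp at hw
    | cons y v =>
      simp only [List.length_cons, Nat.add_right_cancel_iff] at hw
      refine ⟨?_, ?_, ?_⟩
      · refine wf_node.2 ⟨?_, ?_⟩
        · simp only [List.length_append, List.length_map, List.length_cons, List.length_take, List.length_drop,
            List.tail_cons, hw]
          omega
        · refine inL_append.2 ⟨inL_lf _ _, inL_cons.2 ⟨⟨wf_node.2 ⟨?_, ?_⟩, by simp [rootConn]⟩, inL_lf _ _⟩⟩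
          · have := List.length_pos_iff.2 hr0
            simp; omega
          · exact inL_append.2 ⟨inL_lf _ _, hr⟩
      · intro hT
        obtain ⟨x, hx⟩ := falsify hpw
        have h1 := (hkey x).1 (by rw [hT])
        rcases h1 with ⟨p, hp, hpx⟩ | h1
        · rw [hx p (List.mem_of_mem_tail hp)] at hpx
          simp at hpx
        · have := hx y (by simp)
          simp [eval, evalList, eval_lf, this] at h1
      · intro hF
        cases v with
        | nil => simp at hw; omega
        | cons z v =>
          have := (hkey (fun _ => z.2)).2 (Or.inl ⟨z, by simp, by cases hz : z.2 <;> simp [lv, hz]⟩)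
          rw [hF] at this
          simp at this

lemma ind_or {P Q R : Prop} (h : P ↔ Q ∨ R) (h' : ¬ (Q ∧ R)) : ind P = ind Q + ind R := by
  by_cases hQ : Q
  · have hR : ¬ R := fun hR => h' ⟨hQ, hR⟩
    rw [ind_true (h.2 (Or.inl hQ)), ind_true hQ, ind_false hR, add_zero]
  · by_cases hR : R
    · rw [ind_true (h.2 (Or.inr hR)), ind_true hR, ind_false hQ, zero_add]
    · rw [ind_false hR, ind_false hQ, ind_false fun hP => (h.1 hP).elim hQ hR, zero_add]

/-- generating function of trees computing f -/
noncomputable def Tf (n : ℕ) (ρ : ℝ) (f : BF n) : ℝ⟦X⟧ := gw ρ fun t : AT n => ind (WF t ∧ eval t = f)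

lemma Tf_eq (f : BF n) : Tf n ρ f = Uf n ρ true f + Nf n ρ true f := by
  unfold Tf Uf Nf
  rw [← gw_add]
  congr 1
  funext t
  unfold inU
  apply ind_or <;> tauto

lemma T_eq : gw ρ (fun t : AT n => ind (WF t)) = Ut n ρ true + Nt n ρ true := by
  unfold Ut Nt
  rw [← gw_add]
  congr 1
  funext t
  unfold inU
  apply ind_or <;> tauto

lemma Tf_dual : Tf n ρ (fun _ => false) = Tf n ρ (fun _ => true) := by
  unfold Tf
  rw [gw_dual]
  congr 1
  funext t
  congr 1
  rw [wf_dual_iff]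
  congr 1
  apply propext
  rw [funext_iff, funext_iff]
  simp [eval_dual]

lemma count_eq (𝒯 : Set (AT n)) (m : ℕ) :
    ρ ^ m * (countIn n 𝒯 m : ℝ) = coeff m (gw ρ fun t : AT n => ind (t ∈ 𝒯 ∧ WF t)) := by
  classical
  rw [coeff_gw]
  congr 1
  have h1 : ∑ t ∈ fib (AT n) m, ind (t ∈ 𝒯 ∧ WF t)
      = (((fib (AT n) m).filter fun t => t ∈ 𝒯 ∧ WF t).card : ℝ) := by
    rw [Finset.card_filter]
    push_cast
    refine Finset.sum_congr rfl fun t _ => ?_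
    by_cases h : t ∈ 𝒯 ∧ WF t
    · rw [ind_true h, if_pos h]
    · rw [ind_false h, if_neg h]
  rw [h1]
  congr 1
  unfold countIn
  rw [← Nat.card_eq_finsetCard]
  refine Nat.card_congr (Equiv.subtypeEquivRight fun t => ?_)
  rw [Finset.mem_filter, mem_fib, sz_AT]
  tauto

theorem final (hn : 1 ≤ n) : ∃ p : ℝ,
    Tendsto (fun m => Pmn n m (fun _ => true)) atTop (𝓝 p) ∧
    Tendsto (fun m => Pmn n m (fun _ => false)) atTop (𝓝 p) ∧
    Real.exp (-8) / 12 ≤ p ∧ p ≤ 1 / 2 - Real.exp (-4) / 72 := by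
  have hn' : (0 : ℝ) < n := by exact_mod_cast hn
  set s : ℝ := Real.sqrt (2 * n) with hs
  set ρ : ℝ := 1 / (s ^ 2 + 2 * s) with hρ
  have h : Par n s ρ := ⟨hn, Real.sqrt_pos.2 (by positivity), Real.sq_sqrt (by positivity), rfl⟩
  obtain ⟨l, T⟩ := h.tot
  have hl := T.l_pos
  have hρ0 := h.ρ_pos
  have limT : Lim (gw ρ fun t : AT n => ind (WF t)) (2 * l) := by
    rw [T_eq, two_mul]
    exact (T.limU true).add (T.limN true)
  obtain ⟨a, ha⟩ : ∃ a, Lim (Tf n ρ fun _ => true) a := by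
    obtain ⟨a1, h1⟩ := Uf_lim h T (c := true) (fun _ => true)
    obtain ⟨a2, h2⟩ := Nf_lim h T (c := true) (fun _ => true)
    exact ⟨_, by rw [Tf_eq]; exact h1.add h2⟩
  have ha' : Lim (Tf n ρ fun _ => false) a := by rw [Tf_dual]; exact ha
  have hP : ∀ f : BF n, Lim (Tf n ρ f) a → Tendsto (fun m => Pmn n m f) atTop (𝓝 (a / (2 * l))) := by
    intro f hf
    have : ∀ m, Pmn n m f = nv (Tf n ρ f) m / nv (gw ρ fun t : AT n => ind (WF t)) m := by
      intro m
      have e1 := count_eq (ρ := ρ) {t : AT n | eval t = f} m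
      have e2 := count_eq (ρ := ρ) (Set.univ : Set (AT n)) m
      have e3 : (gw ρ fun t : AT n => ind (t ∈ {t : AT n | eval t = f} ∧ WF t)) = Tf n ρ f := by
        unfold Tf
        congr 1
        funext t
        congr 1
        exact propext And.comm
      simp only [Set.mem_univ, true_and] at e2
      rw [e3] at e1
      unfold Pmn A nv
      rw [← e1, ← e2, div_div_div_cancel_right₀ (cc_ne m), mul_div_mul_left _ _ (pow_ne_zero _ hρ0.ne')]
    rw [funext this]
    exact hf.div limT (by positivity)
  refine ⟨a / (2 * l), hP _ ha, hP _ ha', ?_, ?_⟩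
  · have := lower h T ha
    rw [le_div_iff₀ (by positivity)]
    linarith
  · have hnc : Lim (gw ρ fun t : AT n => ind (WF t ∧ eval t ≠ (fun _ => true) ∧ eval t ≠ fun _ => false))
        (2 * l + ((-1) * a + (-1) * a)) := by
      have : (gw ρ fun t : AT n => ind (WF t)) = (gw ρ fun t : AT n => ind (WF t ∧ eval t ≠ (fun _ => true) ∧ eval t ≠ fun _ => false))
          + (Tf n ρ (fun _ => true) + Tf n ρ (fun _ => false)) := by
        unfold Tf
        rw [← gw_add, ← gw_add]
        congr 1
        funext t
        have hne : (fun _ : Fin n → Bool => true) ≠ fun _ => false := fun hh => by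
          have := congrFun hh (fun _ => true); simp at this
        rw [← ind_or (P := WF t ∧ (eval t = (fun _ => true) ∨ eval t = fun _ => false))]
        · apply ind_or <;> tauto
        · tauto
        · rintro ⟨⟨_, h1⟩, _, h2⟩
          exact hne (h1.symm.trans h2)
      have e : (gw ρ fun t : AT n => ind (WF t ∧ eval t ≠ (fun _ => true) ∧ eval t ≠ fun _ => false))
          = (gw ρ fun t : AT n => ind (WF t)) + (C (-1) * Tf n ρ (fun _ => true) + C (-1) * Tf n ρ (fun _ => false)) := by
        rw [this]
        simp only [map_neg, map_one]
        ring
      rw [e]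
      exact limT.add ((ha.smul _).add (ha'.smul _))
    have := upper h T hnc
    rw [div_le_iff₀ (by positivity)]
    linarith

end Sub

/-- There exist real constants `α` and `β` with `0 < α` and `β < 1/2` such that
for every `n ≥ 1`, `P_n(True) = P_n(False)` and `α ≤ P_n(True) ≤ β`. -/
theorem statement1 :
    ∃ α β : ℝ, 0 < α ∧ β < 1/2 ∧
      ∀ n : ℕ, 1 ≤ n → ∃ p : ℝ,
        Filter.Tendsto (fun m => Pmn n m (fun _ => true)) Filter.atTop (nhds p) ∧
        Filter.Tendsto (fun m => Pmn n m (fun _ => false)) Filter.atTop (nhds p) ∧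
        α ≤ p ∧ p ≤ β := by
  refine ⟨Real.exp (-8) / 12, 1 / 2 - Real.exp (-4) / 72, by positivity, ?_, fun n hn => Sub.final hn⟩
  have := Real.exp_pos (-4)
  linarith
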